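/- The satisfiability problem over expanding 2-frames with horizontal frame ⟨ω,<⟩ and all vertical frames difference frames is undecidable: the set of bimodal formulas satisfied in some model based on such an expanding 2-frame is not computable (the lossy-counter-machine ω-reachability problem — given a counter machine M, configuration σ₀=⟨q₀,𝟎⟩ and a state q_r, is it the case that for every n<ω, M has a lossy run starting with σ₀ and visiting q_r at least n times — which is Π₁⁰-hard, is computably many-one reducible to it). -/

import Mathlib

namespace HK

/-! ## Bimodal formulas -/

/-- Bimodal formulas: `φ ::= P | ¬φ | φ∧ψ | ◇₀φ | ◇₁φ`. -/
inductive BForm : Type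
  | var : ℕ → BForm
  | neg : BForm → BForm
  | and : BForm → BForm → BForm
  | dia0 : BForm → BForm
  | dia1 : BForm → BForm

namespace BForm

def imp (φ ψ : BForm) : BForm := neg (and φ (neg ψ))
def bot : BForm := and (var 0) (neg (var 0))
def top : BForm := neg bot
def box0 (φ : BForm) : BForm := neg (dia0 (neg φ))
def box1 (φ : BForm) : BForm := neg (dia1 (neg φ))
/-- `□₀⁺φ := φ ∧ □₀φ` -/
def boxP0 (φ : BForm) : BForm := and φ (box0 φ)
/-- `□₁⁺φ := φ ∧ □₁φ` -/
def boxP1 (φ : BForm) : BForm := and φ (box1 φ)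

/-- Modal nesting depth. -/
def depth : BForm → ℕ
  | var _ => 0
  | neg φ => depth φ
  | and φ ψ => max (depth φ) (depth ψ)
  | dia0 φ => depth φ + 1
  | dia1 φ => depth φ + 1

/-- The propositional variable `k` occurs in the formula. -/
def Occurs (k : ℕ) : BForm → Prop
  | var n => k = n
  | neg φ => Occurs k φ
  | and φ ψ => Occurs k φ ∨ Occurs k ψ
  | dia0 φ => Occurs k φ
  | dia1 φ => Occurs k φ

/-- The formula uses only the modal operator `◇₀`. -/
def OnlyDia0 : BForm → Prop
  | var _ => True
  | neg φ => OnlyDia0 φ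
  | and φ ψ => OnlyDia0 φ ∧ OnlyDia0 ψ
  | dia0 φ => OnlyDia0 φ
  | dia1 _ => False

/-- The formula uses only the modal operator `◇₁`. -/
def OnlyDia1 : BForm → Prop
  | var _ => True
  | neg φ => OnlyDia1 φ
  | and φ ψ => OnlyDia1 φ ∧ OnlyDia1 ψ
  | dia0 _ => False
  | dia1 φ => OnlyDia1 φ

/-- Relativisation `φ^D` of each diamond to the variable `d`:
each subformula `◇ᵢψ` is replaced by `◇ᵢ(D ∧ ψ^D)`. -/
def relativize (d : ℕ) : BForm → BForm
  | var n => var n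
  | neg φ => neg (relativize d φ)
  | and φ ψ => and (relativize d φ) (relativize d ψ)
  | dia0 φ => dia0 (and (var d) (relativize d φ))
  | dia1 φ => dia1 (and (var d) (relativize d φ))

/-- `□₀^k φ` -/
def iterBox0 : ℕ → BForm → BForm
  | 0, φ => φ
  | n+1, φ => box0 (iterBox0 n φ)

/-- `□₁^k φ` -/
def iterBox1 : ℕ → BForm → BForm
  | 0, φ => φ
  | n+1, φ => box1 (iterBox1 n φ)

/-- `□₀^{≤n} φ := ⋀_{k ≤ n} □₀^k φ` -/
def boxLe0 : ℕ → BForm → BForm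
  | 0, φ => φ
  | n+1, φ => and (boxLe0 n φ) (iterBox0 (n+1) φ)

/-- `□₁^{≤n} φ := ⋀_{k ≤ n} □₁^k φ` -/
def boxLe1 : ℕ → BForm → BForm
  | 0, φ => φ
  | n+1, φ => and (boxLe1 n φ) (iterBox1 (n+1) φ)

/-- Uniform substitution. -/
def subst (s : ℕ → BForm) : BForm → BForm
  | var n => s n
  | neg φ => neg (subst s φ)
  | and φ ψ => and (subst s φ) (subst s ψ)
  | dia0 φ => dia0 (subst s φ)
  | dia1 φ => dia1 (subst s φ)

end BForm

/-- Kripke truth over a 2-frame `⟨W, R0, R1⟩` with valuation `val`. -/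
def BSat {W : Type} (R0 R1 : W → W → Prop) (val : ℕ → W → Prop) : W → BForm → Prop
  | w, .var n => val n w
  | w, .neg φ => ¬ BSat R0 R1 val w φ
  | w, .and φ ψ => BSat R0 R1 val w φ ∧ BSat R0 R1 val w ψ
  | w, .dia0 φ => ∃ v, R0 w v ∧ BSat R0 R1 val v φ
  | w, .dia1 φ => ∃ v, R1 w v ∧ BSat R0 R1 val v φ

/-! ## Frames -/

/-- A (unimodal) frame: a nonempty set with a binary relation. -/
structure Frame : Type 1 where
  W : Type
  R : W → W → Prop
  ne : Nonempty W

/-- A 2-frame: a nonempty set with two binary relations. -/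
structure Frame2 : Type 1 where
  W : Type
  R0 : W → W → Prop
  R1 : W → W → Prop
  ne : Nonempty W

/-- Validity of a bimodal formula in a 2-frame. -/
def Frame2.Valid (F : Frame2) (φ : BForm) : Prop :=
  ∀ (val : ℕ → F.W → Prop) (w : F.W), BSat F.R0 F.R1 val w φ

/-- Satisfaction of a bimodal formula in some model based on the 2-frame. -/
def Frame2.Sat (F : Frame2) (φ : BForm) : Prop :=
  ∃ (val : ℕ → F.W → Prop) (w : F.W), BSat F.R0 F.R1 val w φ

/-- Horizontal relation of a product frame. -/
def prodR0 {A B : Type} (R : A → A → Prop) : A × B → A × B → Prop :=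
  fun p q => R p.1 q.1 ∧ p.2 = q.2

/-- Vertical relation of a product frame. -/
def prodR1 {A B : Type} (S : B → B → Prop) : A × B → A × B → Prop :=
  fun p q => p.1 = q.1 ∧ S p.2 q.2

/-- `φ` is satisfied in some model based on the product frame `⟨A,R⟩ × ⟨B,S⟩`. -/
def ProdSat {A B : Type} (R : A → A → Prop) (S : B → B → Prop) (φ : BForm) : Prop :=
  ∃ (val : ℕ → A × B → Prop) (w : A × B), BSat (prodR0 R) (prodR1 S) val w φ

/-- `φ` is valid in the product frame `⟨A,R⟩ × ⟨B,S⟩`. -/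
def ProdValid {A B : Type} (R : A → A → Prop) (S : B → B → Prop) (φ : BForm) : Prop :=
  ∀ (val : ℕ → A × B → Prop) (w : A × B), BSat (prodR0 R) (prodR1 S) val w φ

/-- The product 2-frame of two frames. -/
def prodFrame2 (A B : Type) [Nonempty A] [Nonempty B]
    (R : A → A → Prop) (S : B → B → Prop) : Frame2 :=
  ⟨A × B, prodR0 R, prodR1 S, inferInstance⟩

/-- Linear order: irreflexive, transitive and trichotomous. -/
def IsLin {T : Type} (R : T → T → Prop) : Prop :=
  (∀ x, ¬ R x x) ∧ (∀ x y z, R x y → R y z → R x z) ∧ (∀ x y, R x y ∨ x = y ∨ R y x)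

/-- Weak order: transitive and weakly connected. -/
def WeakOrd {T : Type} (R : T → T → Prop) : Prop :=
  (∀ x y z, R x y → R y z → R x z) ∧ (∀ x y z, R x y → R x z → y = z ∨ R y z ∨ R z y)

/-- Modal discreteness. -/
def ModallyDiscrete {T : Type} (R : T → T → Prop) : Prop :=
  ¬ ∃ (x : ℕ → T) (xω : T), (∀ i, R (x i) (x (i+1))) ∧ (∀ i, x i ≠ x (i+1)) ∧
      (∀ i, R (x i) xω) ∧ (∀ i, ¬ R xω (x i))

/-- No infinite ascending chains of distinct points. -/
def Noetherian {T : Type} (R : T → T → Prop) : Prop :=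
  ¬ ∃ x : ℕ → T, (∀ i, R (x i) (x (i+1))) ∧ (∀ i, x i ≠ x (i+1))

/-- The frame is (isomorphic to) `⟨ω,<⟩`. -/
def IsOmegaFrame (F : Frame) : Prop :=
  ∃ e : F.W ≃ ℕ, ∀ a b, F.R a b ↔ e a < e b

/-- The frame is a finite linear order. -/
def IsFinLinFrame (F : Frame) : Prop := Finite F.W ∧ IsLin F.R

/-- `F` contains an `⟨ω+1,>⟩`-type chain: distinct points `x₀,…,x_n,…,x_ω` with
`x_n R x_m` iff `n > m` (for `n ≠ m`). -/
def HasOmegaPlusOneChain (F : Frame) : Prop :=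
  ∃ (x : ℕ → F.W) (xω : F.W), Function.Injective x ∧ (∀ n, x n ≠ xω) ∧
    (∀ n m, n ≠ m → (F.R (x n) (x m) ↔ m < n)) ∧
    (∀ n, F.R xω (x n)) ∧ (∀ n, ¬ F.R (x n) xω)

/-! ## Two-dimensional (expanding/decreasing) 2-frames `H_{F,Ḡ}` -/

/-- A 2-frame `H_{F,Ḡ}` built from a horizontal frame `⟨H,R⟩` and, for each `x : H`,
a vertical frame `G_x = ⟨D x, S x⟩` carved out of a common ambient type `V`. -/
structure TwoFrame : Type 1 where
  H : Type
  R : H → H → Prop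
  Hne : Nonempty H
  V : Type
  D : H → Set V
  S : H → V → V → Prop
  Dne : ∀ x, (D x).Nonempty

namespace TwoFrame

/-- The horizontal frame. -/
def horiz (T : TwoFrame) : Frame := ⟨T.H, T.R, T.Hne⟩

/-- The vertical frame `G_x` at `x`. -/
def fiber (T : TwoFrame) (x : T.H) : Frame :=
  ⟨{a : T.V // a ∈ T.D x}, fun a b => T.S x a.1 b.1,
    Exists.elim (T.Dne x) (fun a ha => ⟨⟨a, ha⟩⟩)⟩

/-- The worlds `{⟨u,v⟩ : u ∈ H, v ∈ D u}`. -/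
def Worlds (T : TwoFrame) : Type := {p : T.H × T.V // p.2 ∈ T.D p.1}

/-- Horizontal relation of `H_{F,Ḡ}`. -/
def Rh (T : TwoFrame) : T.Worlds → T.Worlds → Prop :=
  fun p q => T.R p.1.1 q.1.1 ∧ p.1.2 = q.1.2

/-- Vertical relation of `H_{F,Ḡ}`. -/
def Rv (T : TwoFrame) : T.Worlds → T.Worlds → Prop :=
  fun p q => p.1.1 = q.1.1 ∧ T.S p.1.1 p.1.2 q.1.2

/-- `φ` is satisfied in some model based on `H_{F,Ḡ}`. -/
def Sat (T : TwoFrame) (φ : BForm) : Prop :=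
  ∃ (val : ℕ → T.Worlds → Prop) (w : T.Worlds), BSat T.Rh T.Rv val w φ

/-- Decreasing 2-frame: `G_y` is a subframe of `G_x` whenever `x R y`. -/
def Decreasing (T : TwoFrame) : Prop :=
  ∀ x y, T.R x y → T.D y ⊆ T.D x ∧ ∀ a ∈ T.D y, ∀ b ∈ T.D y, (T.S y a b ↔ T.S x a b)

/-- Expanding 2-frame: `G_x` is a subframe of `G_y` whenever `x R y`. -/
def Expanding (T : TwoFrame) : Prop :=
  ∀ x y, T.R x y → T.D x ⊆ T.D y ∧ ∀ a ∈ T.D x, ∀ b ∈ T.D x, (T.S x a b ↔ T.S y a b)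

/-- All vertical frames are difference frames. -/
def DiffFibers (T : TwoFrame) : Prop :=
  ∀ x, ∀ a ∈ T.D x, ∀ b ∈ T.D x, (T.S x a b ↔ a ≠ b)

end TwoFrame

/-- `φ` is satisfied in some model based on a product of a member of `C`
with a difference frame. -/
def ProdDiffSat (C : Frame → Prop) (φ : BForm) : Prop :=
  ∃ F : Frame, C F ∧ ∃ D : Type, Nonempty D ∧ ProdSat F.R (fun a b : D => a ≠ b) φ

/-- `φ` is satisfied in some model based on a decreasing 2-frame with horizontal
frame in `C` and all vertical frames difference frames. -/
def DecDiffSat (C : Frame → Prop) (φ : BForm) : Prop :=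
  ∃ T : TwoFrame, C T.horiz ∧ T.Decreasing ∧ T.DiffFibers ∧ T.Sat φ

/-- `φ` is satisfied in some model based on an expanding 2-frame with horizontal
frame in `C` and all vertical frames difference frames. -/
def ExpDiffSat (C : Frame → Prop) (φ : BForm) : Prop :=
  ∃ T : TwoFrame, C T.horiz ∧ T.Expanding ∧ T.DiffFibers ∧ T.Sat φ

/-- `φ` is satisfied in some model based on a product of a member of `C0` with a
member of `C1`. -/
def ProdClassSat (C0 C1 : Frame → Prop) (φ : BForm) : Prop :=
  ∃ F0, C0 F0 ∧ ∃ F1, C1 F1 ∧ ProdSat F0.R F1.R φ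

/-- `φ` is satisfied in some model based on a decreasing 2-frame with horizontal
frame in `C0` and all vertical frames in `C1`. -/
def DecClassSat (C0 C1 : Frame → Prop) (φ : BForm) : Prop :=
  ∃ T : TwoFrame, C0 T.horiz ∧ (∀ x, C1 (T.fiber x)) ∧ T.Decreasing ∧ T.Sat φ

/-- `φ` is satisfied in some model based on an expanding 2-frame with horizontal
frame in `C0` and all vertical frames in `C1`. -/
def ExpClassSat (C0 C1 : Frame → Prop) (φ : BForm) : Prop :=
  ∃ T : TwoFrame, C0 T.horiz ∧ (∀ x, C1 (T.fiber x)) ∧ T.Expanding ∧ T.Sat φ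

/-- Satisfiability over products of `⟨ω,<⟩` with difference frames. -/
def OmegaDiffSat (φ : BForm) : Prop :=
  ∃ D : Type, Nonempty D ∧ ProdSat (fun m n : ℕ => m < n) (fun a b : D => a ≠ b) φ

/-- Satisfiability over products of finite linear orders with difference frames. -/
def FinLinDiffSat (φ : BForm) : Prop :=
  ∃ (T : Type) (R : T → T → Prop), Finite T ∧ IsLin R ∧
    ∃ D : Type, Nonempty D ∧ ProdSat R (fun a b : D => a ≠ b) φ

/-! ## Bimodal logics -/

/-- Propositional tautology (diamond formulas treated as atoms). -/
def IsTaut (φ : BForm) : Prop :=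
  ∀ v : BForm → Prop, (∀ ψ, v (BForm.neg ψ) ↔ ¬ v ψ) →
    (∀ ψ χ, v (BForm.and ψ χ) ↔ v ψ ∧ v χ) → v φ

/-- Normal bimodal logic. -/
structure IsLogic (L : Set BForm) : Prop where
  taut : ∀ φ, IsTaut φ → φ ∈ L
  K0 : BForm.imp (BForm.box0 (BForm.imp (BForm.var 0) (BForm.var 1)))
        (BForm.imp (BForm.box0 (BForm.var 0)) (BForm.box0 (BForm.var 1))) ∈ L
  K1 : BForm.imp (BForm.box1 (BForm.imp (BForm.var 0) (BForm.var 1)))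
        (BForm.imp (BForm.box1 (BForm.var 0)) (BForm.box1 (BForm.var 1))) ∈ L
  mp : ∀ φ ψ, BForm.imp φ ψ ∈ L → φ ∈ L → ψ ∈ L
  subst : ∀ φ s, φ ∈ L → BForm.subst s φ ∈ L
  nec0 : ∀ φ, φ ∈ L → BForm.box0 φ ∈ L
  nec1 : ∀ φ, φ ∈ L → BForm.box1 φ ∈ L

/-- Validity of a (◇₀-)formula in a unimodal frame `⟨W,R⟩`. -/
def UValid0 {W : Type} (R : W → W → Prop) (φ : BForm) : Prop :=
  ∀ (val : ℕ → W → Prop) (w : W), BSat R (fun _ _ => False) val w φ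

/-- Validity of a (◇₁-)formula in a unimodal frame `⟨W,S⟩`. -/
def UValid1 {W : Type} (S : W → W → Prop) (φ : BForm) : Prop :=
  ∀ (val : ℕ → W → Prop) (w : W), BSat (fun _ _ => False) S val w φ

/-- `K4.3`: the unimodal logic (in `◇₀`) of all linear orders. -/
def K43 : Set BForm :=
  {φ | φ.OnlyDia0 ∧ ∀ (T : Type) (R : T → T → Prop), Nonempty T → IsLin R → UValid0 R φ}

/-- `Diff`: the unimodal logic (in `◇₁`) of all difference frames. -/
def DiffLogic : Set BForm :=
  {φ | φ.OnlyDia1 ∧ ∀ (D : Type), Nonempty D → UValid1 (fun a b : D => a ≠ b) φ}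

/-- `Log⟨ω,<⟩`: the unimodal logic (in `◇₀`) of the frame `⟨ω,<⟩`. -/
def LogOmega : Set BForm :=
  {φ | φ.OnlyDia0 ∧ UValid0 (fun m n : ℕ => m < n) φ}

/-- `GL.3`: the unimodal logic (in `◇₀`) of all Noetherian irreflexive linear orders. -/
def GL3 : Set BForm :=
  {φ | φ.OnlyDia0 ∧
    ∀ (T : Type) (R : T → T → Prop), Nonempty T → IsLin R → Noetherian R → UValid0 R φ}

/-- `DisK4.3`: the unimodal logic (in `◇₀`) of all modally discrete weak orders. -/
def DisK43 : Set BForm :=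
  {φ | φ.OnlyDia0 ∧
    ∀ (T : Type) (R : T → T → Prop), Nonempty T → WeakOrd R → ModallyDiscrete R → UValid0 R φ}

def commAx1 : BForm :=
  BForm.imp (BForm.box1 (BForm.box0 (BForm.var 0))) (BForm.box0 (BForm.box1 (BForm.var 0)))
def commAx2 : BForm :=
  BForm.imp (BForm.box0 (BForm.box1 (BForm.var 0))) (BForm.box1 (BForm.box0 (BForm.var 0)))
def commAx3 : BForm :=
  BForm.imp (BForm.dia0 (BForm.box1 (BForm.var 0))) (BForm.box1 (BForm.dia0 (BForm.var 0)))

/-- The commutator `[L0,L1]`: the smallest bimodal logic containing `L0`, `L1` (and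
hence their fusion) together with the commutativity/confluence axioms. -/
def Commutator (L0 L1 : Set BForm) : Set BForm :=
  ⋂₀ {L : Set BForm | IsLogic L ∧ L0 ⊆ L ∧ L1 ⊆ L ∧
      commAx1 ∈ L ∧ commAx2 ∈ L ∧ commAx3 ∈ L}

/-- The product logic `L0 × L1`: the logic of all products of a frame for `L0`
with a frame for `L1`. -/
def ProdLogic (L0 L1 : Set BForm) : Set BForm :=
  {φ | ∀ (A B : Type), Nonempty A → Nonempty B → ∀ (R : A → A → Prop) (S : B → B → Prop),
      (∀ ψ ∈ L0, UValid0 R ψ) → (∀ ψ ∈ L1, UValid1 S ψ) → ProdValid R S φ}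

/-- The logic of a class of 2-frames. -/
def LogOf (C : Frame2 → Prop) : Set BForm := {φ | ∀ F, C F → F.Valid φ}

/-- Kripke completeness of a bimodal logic. -/
def KripkeComplete (L : Set BForm) : Prop := ∃ C : Frame2 → Prop, L = LogOf C

/-- `L`-satisfiability: `φ` is satisfied in some model `M` with `M ⊨ L`. -/
def LSat (L : Set BForm) (φ : BForm) : Prop :=
  ∃ (W : Type) (_ : Nonempty W) (R0 R1 : W → W → Prop) (val : ℕ → W → Prop),
    (∀ ψ ∈ L, ∀ w, BSat R0 R1 val w ψ) ∧ ∃ w, BSat R0 R1 val w φ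

/-! ## One-variable first-order temporal logic with counting (FOLTL≠) -/

/-- FOLTL≠-formulas: `φ ::= P(x) | ¬φ | φ∧ψ | ◇_F φ | ∃≠x φ`. -/
inductive TForm : Type
  | atom : ℕ → TForm
  | neg : TForm → TForm
  | and : TForm → TForm → TForm
  | diaF : TForm → TForm
  | exNe : TForm → TForm

/-- Truth of an FOLTL≠-formula in a first-order temporal model based on the
timeline `⟨T,lt⟩` with domains `D` and interpretation `I`. -/
def TSat {T U : Type} (lt : T → T → Prop) (D : T → Set U) (I : ℕ → T → U → Prop) :
    T → U → TForm → Prop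
  | t, a, .atom n => I n t a
  | t, a, .neg φ => ¬ TSat lt D I t a φ
  | t, a, .and φ ψ => TSat lt D I t a φ ∧ TSat lt D I t a ψ
  | t, a, .diaF φ => ∃ t', lt t t' ∧ a ∈ D t' ∧ TSat lt D I t' a φ
  | t, a, .exNe φ => ∃ b, b ∈ D t ∧ b ≠ a ∧ TSat lt D I t b φ

/-- The standard translation `⋆` from FOLTL≠-formulas to bimodal formulas. -/
def TForm.star : TForm → BForm
  | .atom n => .var n
  | .neg φ => .neg (TForm.star φ)
  | .and φ ψ => .and (TForm.star φ) (TForm.star ψ)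
  | .diaF φ => .dia0 (TForm.star φ)
  | .exNe φ => .dia1 (TForm.star φ)

/-- Satisfiability in constant domain models over the timeline `⟨T,lt⟩`. -/
def FOLTLConstSat {T : Type} (lt : T → T → Prop) (φ : TForm) : Prop :=
  ∃ (U : Type) (I : ℕ → T → U → Prop) (t : T) (a : U),
    TSat lt (fun _ => (Set.univ : Set U)) I t a φ

/-- Satisfiability in decreasing domain models over the timeline `⟨T,lt⟩`. -/
def FOLTLDecSat {T : Type} (lt : T → T → Prop) (φ : TForm) : Prop :=
  ∃ (U : Type) (D : T → Set U), (∀ t, (D t).Nonempty) ∧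
    (∀ t t', lt t t' → D t' ⊆ D t) ∧
    ∃ (I : ℕ → T → U → Prop) (t : T) (a : U), a ∈ D t ∧ TSat lt D I t a φ

/-- Satisfiability in expanding domain models over the timeline `⟨T,lt⟩`. -/
def FOLTLExpSat {T : Type} (lt : T → T → Prop) (φ : TForm) : Prop :=
  ∃ (U : Type) (D : T → Set U), (∀ t, (D t).Nonempty) ∧
    (∀ t t', lt t t' → D t ⊆ D t') ∧
    ∃ (I : ℕ → T → U → Prop) (t : T) (a : U), a ∈ D t ∧ TSat lt D I t a φ

/-- Satisfiability in constant domain models over a class `C` of timelines. -/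
def FOLTLConstSatC (C : Frame → Prop) (φ : TForm) : Prop :=
  ∃ F, C F ∧ FOLTLConstSat F.R φ

/-- Satisfiability in decreasing domain models over a class `C` of timelines. -/
def FOLTLDecSatC (C : Frame → Prop) (φ : TForm) : Prop :=
  ∃ F, C F ∧ FOLTLDecSat F.R φ

/-- Satisfiability in expanding domain models over a class `C` of timelines. -/
def FOLTLExpSatC (C : Frame → Prop) (φ : TForm) : Prop :=
  ∃ F, C F ∧ FOLTLExpSat F.R φ

/-- The class of all linear orders. -/
def AllLin : Frame → Prop := fun F => IsLin F.R

/-- The class of all finite linear orders. -/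
def AllFinLin : Frame → Prop := IsFinLinFrame

/-! ## Gödel numbering -/

/-- A fixed effective Gödel numbering of bimodal formulas. -/
def encodeB : BForm → ℕ
  | .var n => Nat.pair 0 n
  | .neg φ => Nat.pair 1 (encodeB φ)
  | .and φ ψ => Nat.pair 2 (Nat.pair (encodeB φ) (encodeB ψ))
  | .dia0 φ => Nat.pair 3 (encodeB φ)
  | .dia1 φ => Nat.pair 4 (encodeB φ)

/-- A fixed effective Gödel numbering of FOLTL≠-formulas. -/
def encodeT : TForm → ℕ
  | .atom n => Nat.pair 0 n
  | .neg φ => Nat.pair 1 (encodeT φ)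
  | .and φ ψ => Nat.pair 2 (Nat.pair (encodeT φ) (encodeT ψ))
  | .diaF φ => Nat.pair 3 (encodeT φ)
  | .exNe φ => Nat.pair 4 (encodeT φ)

/-- The set of codes of bimodal formulas with property `P`. -/
def BCodes (P : BForm → Prop) : ℕ → Prop := fun n => ∃ φ, encodeB φ = n ∧ P φ

/-- The set of codes of FOLTL≠-formulas with property `P`. -/
def TCodes (P : TForm → Prop) : ℕ → Prop := fun n => ∃ φ, encodeT φ = n ∧ P φ

/-! ## The analytical hierarchy: Σ₁¹ -/

/-- `A ⊆ ℕ` is `Σ₁¹`: in normal form `n ∈ A ↔ ∃ f : ℕ → ℕ, ∀ m, R (n, f̄(m))`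
for a computable predicate `R` of the number `n` and finite initial segments of `f`. -/
def Sigma11 (A : ℕ → Prop) : Prop :=
  ∃ R : ℕ × List ℕ → Prop, ComputablePred R ∧
    ∀ n, A n ↔ ∃ f : ℕ → ℕ, ∀ m, R (n, (List.range m).map f)

/-- `Σ₁¹`-hardness with respect to computable many-one reducibility. -/
def Sigma11Hard (A : ℕ → Prop) : Prop := ∀ B : ℕ → Prop, Sigma11 B → ManyOneReducible B A

/-- `Σ₁¹`-completeness. -/
def Sigma11Complete (A : ℕ → Prop) : Prop := Sigma11 A ∧ Sigma11Hard A

/-! ## Counter (Minsky) machines -/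

/-- Counter machine operations: `inl i` increments counter `i`, `inr (inl i)`
decrements counter `i`, `inr (inr i)` zero-tests counter `i`. -/
abbrev CMOp : Type := ℕ ⊕ ℕ ⊕ ℕ

def CMOp.counter : CMOp → ℕ
  | Sum.inl i => i
  | Sum.inr (Sum.inl i) => i
  | Sum.inr (Sum.inr i) => i

/-- Description of a counter machine: number `N` of counters, number of states
(states are `0,…,states-1`), list of terminal states, and list of instructions
`(q, op, q')`. -/
abbrev CMDesc : Type := ℕ × ℕ × List ℕ × List (ℕ × CMOp × ℕ)

/-- Well-formedness of a counter machine description: `N > 1`, terminal states are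
states, instructions are attached to non-terminal states and mention genuine
counters, and every non-terminal state has at least one instruction. -/
def CMWF (M : CMDesc) : Prop :=
  1 < M.1 ∧ (∀ q ∈ M.2.2.1, q < M.2.1) ∧
  (∀ t ∈ M.2.2.2, t.1 < M.2.1 ∧ t.1 ∉ M.2.2.1 ∧ t.2.2 < M.2.1 ∧ CMOp.counter t.2.1 < M.1) ∧
  (∀ q, q < M.2.1 → q ∉ M.2.2.1 → ∃ t ∈ M.2.2.2, t.1 = q)

/-- A configuration: current state and contents of the counters. -/
abbrev CMConfig : Type := ℕ × (ℕ → ℕ)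

/-- Reliable step of a counter machine. -/
def CMStep (M : CMDesc) (σ σ' : CMConfig) : Prop :=
  ∃ op q', (σ.1, op, q') ∈ M.2.2.2 ∧ σ'.1 = q' ∧
    match op with
    | Sum.inl i => σ'.2 i = σ.2 i + 1 ∧ ∀ j, j ≠ i → σ'.2 j = σ.2 j
    | Sum.inr (Sum.inl i) => 0 < σ.2 i ∧ σ'.2 i + 1 = σ.2 i ∧ ∀ j, j ≠ i → σ'.2 j = σ.2 j
    | Sum.inr (Sum.inr i) => σ.2 i = 0 ∧ ∀ j, σ'.2 j = σ.2 j

/-- Lossy step of a counter machine. -/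
def CMStepLossy (M : CMDesc) (σ σ' : CMConfig) : Prop :=
  ∃ c1 c2 : ℕ → ℕ, CMStep M (σ.1, c1) (σ'.1, c2) ∧ (∀ i, c1 i ≤ σ.2 i) ∧ (∀ i, σ'.2 i ≤ c2 i)

/-- The configuration `⟨q, 𝟎⟩` with all-0 counters. -/
def zeroConfig (q : ℕ) : CMConfig := (q, fun _ => 0)

/-- CM non-termination: the machine has an infinite run starting with `⟨q₀,𝟎⟩`. -/
def CMNonTerm : CMDesc × ℕ → Prop := fun p =>
  CMWF p.1 ∧ ∃ ρ : ℕ → CMConfig, ρ 0 = zeroConfig p.2 ∧ ∀ n, CMStep p.1 (ρ n) (ρ (n+1))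

/-- CM reachability: the machine has a run starting with `⟨q₀,𝟎⟩` reaching `q_r`. -/
def CMReach : CMDesc × ℕ × ℕ → Prop := fun p =>
  CMWF p.1 ∧ ∃ (B : ℕ) (ρ : ℕ → CMConfig), ρ 0 = zeroConfig p.2.1 ∧
    (∀ n, n < B → CMStep p.1 (ρ n) (ρ (n+1))) ∧ (ρ B).1 = p.2.2

/-- CM recurrence: the machine has an infinite run starting with `⟨q₀,𝟎⟩`
visiting `q_r` infinitely often. -/
def CMRecur : CMDesc × ℕ × ℕ → Prop := fun p =>
  CMWF p.1 ∧ ∃ ρ : ℕ → CMConfig, ρ 0 = zeroConfig p.2.1 ∧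
    (∀ n, CMStep p.1 (ρ n) (ρ (n+1))) ∧ ∀ n, ∃ m, n ≤ m ∧ (ρ m).1 = p.2.2

/-- LCM reachability: the machine has a lossy run starting with `⟨q₀,𝟎⟩`
reaching `q_r`. -/
def LCMReach : CMDesc × ℕ × ℕ → Prop := fun p =>
  CMWF p.1 ∧ ∃ (B : ℕ) (ρ : ℕ → CMConfig), ρ 0 = zeroConfig p.2.1 ∧
    (∀ n, n < B → CMStepLossy p.1 (ρ n) (ρ (n+1))) ∧ (ρ B).1 = p.2.2

/-- LCM ω-reachability: for every `k`, the machine has a lossy run starting with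
`⟨q₀,𝟎⟩` visiting `q_r` at least `k` times. -/
def LCMOmegaReach : CMDesc × ℕ × ℕ → Prop := fun p =>
  CMWF p.1 ∧ ∀ k : ℕ, ∃ (B : ℕ) (ρ : ℕ → CMConfig), ρ 0 = zeroConfig p.2.1 ∧
    (∀ n, n < B → CMStepLossy p.1 (ρ n) (ρ (n+1))) ∧
    k ≤ ((Finset.range (B+1)).filter (fun n => (ρ n).1 = p.2.2)).card

/-! ## Particular formulas used in the statements -/

/-- `□₁⁺□₀⁺(◇₀⊤ → □₁◇₀⊤) ∧ φ` (Prop. 2.4 of the paper). -/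
def diffDecForm (φ : BForm) : BForm :=
  BForm.and
    (BForm.boxP1 (BForm.boxP0
      (BForm.imp (BForm.dia0 BForm.top) (BForm.box1 (BForm.dia0 BForm.top))))) φ

/-- `D ∧ □₀^{≤n}□₁^{≤n}(◇₀D → D) ∧ φ^D`. -/
def decRelForm (d n : ℕ) (φ : BForm) : BForm :=
  BForm.and (BForm.var d)
    (BForm.and
      (BForm.boxLe0 n (BForm.boxLe1 n
        (BForm.imp (BForm.dia0 (BForm.var d)) (BForm.var d))))
      (BForm.relativize d φ))

/-- `D ∧ □₀^{≤n}□₁^{≤n}(D → □₀D) ∧ φ^D`. -/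
def expRelForm (d n : ℕ) (φ : BForm) : BForm :=
  BForm.and (BForm.var d)
    (BForm.and
      (BForm.boxLe0 n (BForm.boxLe1 n
        (BForm.imp (BForm.var d) (BForm.box0 (BForm.var d)))))
      (BForm.relativize d φ))

section partA1
/-! ## Lossy runs with a visit counter -/

inductive LRun (M : CMDesc) (q0 qr : ℕ) : CMConfig → ℕ → Prop
  | start : LRun M q0 qr (zeroConfig q0) 0
  | step {σ σ' v} : LRun M q0 qr σ v → CMStepLossy M σ σ' →
      LRun M q0 qr σ' (v + if σ'.1 = qr then 1 else 0)

/-- the property of a function-like run -/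
def FRun (M : CMDesc) (q0 : ℕ) (B : ℕ) (ρ : ℕ → CMConfig) : Prop :=
  ρ 0 = zeroConfig q0 ∧ ∀ n, n < B → CMStepLossy M (ρ n) (ρ (n+1))

theorem LRun.toFun {M : CMDesc} {q0 qr : ℕ} {σ v} (h : LRun M q0 qr σ v) :
    ∃ (B : ℕ) (ρ : ℕ → CMConfig), FRun M q0 B ρ ∧ ρ B = σ ∧
    v ≤ ((Finset.range (B+1)).filter (fun n => (ρ n).1 = qr)).card := by
  induction h with
  | start => exact ⟨0, fun _ => zeroConfig q0, ⟨rfl, by simp⟩, rfl, by simp⟩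
  | @step σ σ' v _ hs ih =>
    obtain ⟨B, ρ, ⟨h0, h1⟩, h2, h3⟩ := ih
    refine ⟨B+1, fun n => if n ≤ B then ρ n else σ', ⟨by simpa using h0, ?_⟩, by simp, ?_⟩
    · intro n hn
      rcases Nat.lt_or_ge n B with h | h
      · have a : n ≤ B := h.le
        have b : n + 1 ≤ B := h
        simpa [a, b] using h1 n h
      · have : n = B := by omega
        subst this
        simpa [h2] using hs
    · rw [Finset.range_add_one, Finset.filter_insert]
      have e : (Finset.range (B+1)).filter (fun n => ((if n ≤ B then ρ n else σ' : CMConfig)).1 = qr)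
          = (Finset.range (B+1)).filter (fun n => (ρ n).1 = qr) := by
        apply Finset.filter_congr
        intro n hn
        have : n ≤ B := by simpa [Nat.lt_succ_iff] using hn
        simp [this]
      rw [e]
      by_cases hq : σ'.1 = qr
      · simp [hq]; exact h3
      · simpa [hq] using h3

/-- The combinatorial content of a model of the formula. -/
structure Enc (M : CMDesc) (q0 qr : ℕ) (V : Type) where
  E : ℕ → Prop
  Q : ℕ → ℕ → Prop
  C : ℕ → ℕ → Set V
  inf : ∀ m, ∃ m', m < m' ∧ E m'
  eF : ∀ m, E m → C 0 m ⊆ C 0 (m+1) ∧ ∃ x, x ∉ C 0 m ∧ x ∈ C 0 (m+1)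
  disj : ∀ m m', m < m' → E m → E m' → ∀ x ∈ C 0 m, x ∉ C 0 m'
  ex : ∀ m, ∃ q, Q q m
  fin : ∀ m q, Q q m → E m → q = q0 ∧ ∀ j < M.1, C (j+1) m = ∅
  stepF : ∀ m q, Q q m → ¬ E m → (C 0 m ⊆ C 0 (m+1) ∨ (q = qr ∧ (∃ y, C 0 m ⊆ insert y (C 0 (m+1))) ∧
      ∃ x, x ∉ C 0 m ∧ x ∈ C 0 (m+1)))
  step : ∀ m q, Q q m → ¬ E m → ∃ t ∈ M.2.2.2, t.2.2 = q ∧ Q t.1 (m+1) ∧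
      (∀ j < M.1, if t.2.1 = Sum.inl j then (∃ y, C (j+1) m ⊆ insert y (C (j+1) (m+1)))
        else C (j+1) m ⊆ C (j+1) (m+1)) ∧
      (∀ i, t.2.1 = Sum.inr (Sum.inl i) → ∃ x, x ∉ C (i+1) m ∧ x ∈ C (i+1) (m+1)) ∧
      (∀ i, t.2.1 = Sum.inr (Sum.inr i) → C (i+1) m = ∅)

namespace Enc
variable {M : CMDesc} {q0 qr : ℕ} {V : Type}

theorem back (S : Enc M q0 qr V) (hM : CMWF M) (e : ℕ) (he : S.E e) : ∀ d m q, m + d = e →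
    (∀ m', m ≤ m' → m' < e → ¬ S.E m') → S.Q q m →
    ∀ c : ℕ → ℕ, (∀ j < M.1, (c j : ℕ∞) ≤ (S.C (j+1) m).encard) → (∀ j, M.1 ≤ j → c j = 0) →
    ∃ v, LRun M q0 qr (q, c) v ∧ (S.C 0 m \ S.C 0 e).encard ≤ v := by
  intro d
  induction d with
  | zero =>
    intro m q hm _ hq c hc hc0
    obtain rfl : m = e := by omega
    obtain ⟨rfl, hz⟩ := S.fin _ _ hq he
    have : c = fun _ => 0 := by
      funext j
      rcases Nat.lt_or_ge j M.1 with h | h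
      · have := hc j h
        rw [hz j h] at this
        simpa using this
      · exact hc0 j h
    subst this
    exact ⟨0, LRun.start, by simp⟩
  | succ d ih =>
    intro m q hm hE hq c hc hc0
    have hmE : ¬ S.E m := hE m le_rfl (by omega)
    obtain ⟨⟨p, op, q'⟩, ht, rfl, hQ, hop, hdec, hzt⟩ := S.step m q hq hmE
    have hcount := (hM.2.2.1 _ ht).2.2.2
    have hF := S.stepF m _ hq hmE
    simp only at hQ hop hdec hzt hcount hF hq
    -- the visits part
    have key : ∀ v : ℕ, (S.C 0 (m+1) \ S.C 0 e).encard ≤ v →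
        (S.C 0 m \ S.C 0 e).encard ≤ ((v + if q' = qr then 1 else 0 : ℕ) : ℕ∞) := by
      intro v hv
      rcases hF with h | ⟨h1, ⟨y, h2⟩, -⟩
      · calc _ ≤ (S.C 0 (m+1) \ S.C 0 e).encard := Set.encard_le_encard (Set.sdiff_subset_sdiff_left h)
          _ ≤ v := hv
          _ ≤ _ := by exact_mod_cast Nat.le_add_right _ _
      · calc _ ≤ (insert y (S.C 0 (m+1) \ S.C 0 e)).encard := by
              apply Set.encard_le_encard
              intro x hx
              rcases h2 hx.1 with h | h
              · exact Or.inl h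
              · exact Or.inr ⟨h, hx.2⟩
          _ ≤ (S.C 0 (m+1) \ S.C 0 e).encard + 1 := Set.encard_insert_le _ _
          _ ≤ (v : ℕ∞) + 1 := by gcongr
          _ = _ := by simp [h1]
    have fin : ∀ c' : ℕ → ℕ, (∀ j < M.1, (c' j : ℕ∞) ≤ (S.C (j+1) (m+1)).encard) →
        (∀ j, M.1 ≤ j → c' j = 0) → CMStepLossy M (p, c') (q', c) →
        ∃ v, LRun M q0 qr (q', c) v ∧ (S.C 0 m \ S.C 0 e).encard ≤ v := by
      intro c' h1 h2 h3
      obtain ⟨v, hv, hv2⟩ := ih (m+1) p (by omega) (fun m' h h' => hE m' (by omega) h') hQ c' h1 h2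
      exact ⟨_, hv.step h3, key v hv2⟩
    have hsub : ∀ j < M.1, op ≠ Sum.inl j → (c j : ℕ∞) ≤ (S.C (j+1) (m+1)).encard := by
      intro j hj hne
      have := hop j hj
      rw [if_neg hne] at this
      exact (hc j hj).trans (Set.encard_le_encard this)
    rcases op with i | i | i
    · -- increment
      simp only [CMOp.counter] at hcount
      apply fin (Function.update c i (c i - 1))
      · intro j hj
        by_cases hji : j = i
        · subst hji
          have := hop j hj
          rw [if_pos rfl] at this
          obtain ⟨y, hy⟩ := this
          have h1 := ((hc j hj).trans (Set.encard_le_encard hy)).trans (Set.encard_insert_le _ _)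
          simp only [Function.update_self]
          rcases Nat.eq_zero_or_pos (c j) with h | h
          · simp [h]
          · obtain ⟨k, hk⟩ : ∃ k, c j = k + 1 := ⟨c j - 1, by omega⟩
            rw [hk] at h1 ⊢
            push_cast at h1
            have := (ENat.add_le_add_iff_right (by simp)).1 h1
            simpa using this
        · rw [Function.update_of_ne hji]
          exact hsub j hj (by simpa using Ne.symm hji)
      · intro j hj
        rw [Function.update_of_ne (by omega)]
        exact hc0 j hj
      · refine ⟨Function.update c i (c i - 1), Function.update c i (c i - 1 + 1),
          ⟨_, _, ht, rfl, ?_⟩, fun _ => le_rfl, ?_⟩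
        · simp +contextual
        · intro j
          by_cases hji : j = i
          · subst hji; simp; omega
          · simp [hji]
    · -- decrement
      simp only [CMOp.counter] at hcount
      apply fin (Function.update c i (c i + 1))
      · intro j hj
        by_cases hji : j = i
        · subst hji
          have := hop j hj
          rw [if_neg (by simp)] at this
          obtain ⟨x, hx, hx'⟩ := hdec j rfl
          simp only [Function.update_self]
          push_cast
          calc (c j : ℕ∞) + 1 ≤ (S.C (j+1) m).encard + 1 := by gcongr; exact hc j hj
            _ = (insert x (S.C (j+1) m)).encard := (Set.encard_insert_of_notMem hx).symm
            _ ≤ _ := Set.encard_le_encard (Set.insert_subset hx' this)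
        · rw [Function.update_of_ne hji]
          exact hsub j hj (by simp)
      · intro j hj
        rw [Function.update_of_ne (by omega)]
        exact hc0 j hj
      · refine ⟨Function.update c i (c i + 1), c,
          ⟨_, _, ht, rfl, ?_⟩, fun _ => le_rfl, fun _ => le_rfl⟩
        simp +contextual
    · -- zero test
      simp only [CMOp.counter] at hcount
      apply fin c
      · intro j hj
        exact hsub j hj (by simp)
      · exact hc0
      · refine ⟨c, c, ⟨_, _, ht, rfl, ?_, fun _ => rfl⟩, fun _ => le_rfl, fun _ => le_rfl⟩
        have := hc i hcount
        rw [hzt i rfl] at this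
        simpa using this

theorem growStep (S : Enc M q0 qr V) (m : ℕ) : (S.C 0 m).encard ≤ (S.C 0 (m+1)).encard := by
  by_cases hE : S.E m
  · exact Set.encard_le_encard (S.eF m hE).1
  · obtain ⟨q, hq⟩ := S.ex m
    rcases S.stepF m q hq hE with h | ⟨-, ⟨y, h2⟩, x, hx, hx'⟩
    · exact Set.encard_le_encard h
    · calc (S.C 0 m).encard ≤ (insert y (S.C 0 m \ {y})).encard := by
            apply Set.encard_le_encard; simp
        _ ≤ (S.C 0 m \ {y}).encard + 1 := Set.encard_insert_le _ _
        _ = (insert x (S.C 0 m \ {y})).encard :=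
            (Set.encard_insert_of_notMem (fun h => hx h.1)).symm
        _ ≤ _ := by
            apply Set.encard_le_encard
            apply Set.insert_subset hx'
            intro z hz
            exact (h2 hz.1).resolve_left hz.2

theorem growMono (S : Enc M q0 qr V) : Monotone (fun m => (S.C 0 m).encard) :=
  monotone_nat_of_le_succ S.growStep

theorem growE (S : Enc M q0 qr V) (k : ℕ) : ∃ e, S.E e ∧ (k : ℕ∞) ≤ (S.C 0 e).encard := by
  induction k with
  | zero => obtain ⟨e, -, he⟩ := S.inf 0; exact ⟨e, he, by simp⟩
  | succ k ih =>
    obtain ⟨e, he, hk⟩ := ih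
    obtain ⟨e', hlt, he'⟩ := S.inf e
    refine ⟨e', he', ?_⟩
    obtain ⟨h1, x, hx, hx'⟩ := S.eF e he
    push_cast
    calc (k : ℕ∞) + 1 ≤ (S.C 0 e).encard + 1 := by gcongr
      _ = (insert x (S.C 0 e)).encard := (Set.encard_insert_of_notMem hx).symm
      _ ≤ (S.C 0 (e+1)).encard := Set.encard_le_encard (Set.insert_subset hx' h1)
      _ ≤ _ := S.growMono hlt

theorem reach (S : Enc M q0 qr V) (hM : CMWF M) : LCMOmegaReach (M, q0, qr) := by
  classical
  refine ⟨hM, fun k => ?_⟩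
  obtain ⟨e, he, hk⟩ := S.growE k
  have hex := S.inf e
  let e' := Nat.find hex
  obtain ⟨hlt, he'⟩ := Nat.find_spec hex
  obtain ⟨q, hq⟩ := S.ex (e+1)
  obtain ⟨v, hv, hv2⟩ := S.back hM e' he' (e' - (e+1)) (e+1) q (by omega)
    (fun m' h1 h2 h3 => Nat.find_min hex h2 ⟨h1, h3⟩) hq (fun _ => 0) (by simp) (by simp)
  obtain ⟨B, ρ, ⟨h0, h1⟩, -, h3⟩ := hv.toFun
  refine ⟨B, ρ, h0, h1, le_trans ?_ h3⟩
  have : (k : ℕ∞) ≤ v := by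
    refine (hk.trans (Set.encard_le_encard ?_)).trans hv2
    intro x hx
    exact ⟨(S.eF e he).1 hx, S.disj e e' hlt he he' x hx⟩
  exact_mod_cast this

end Enc
end partA1

section partA2
/-! ## The formula -/

def orF (φ ψ : BForm) : BForm := .neg (.and (.neg φ) (.neg ψ))
def diaP1 (φ : BForm) : BForm := orF φ (.dia1 φ)
def conjF {β : Type} (l : List β) (f : β → BForm) : BForm :=
  l.foldr (fun b φ => .and (f b) φ) BForm.top
def disjF {β : Type} (l : List β) (f : β → BForm) : BForm :=
  l.foldr (fun b φ => orF (f b) φ) BForm.bot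

def nV : BForm := .var 0
def eV : BForm := .var 1
def qV (q : ℕ) : BForm := .var (3 * q + 2)
def aV (j : ℕ) : BForm := .var (3 * j + 3)
def bV (j : ℕ) : BForm := .var (3 * j + 4)

def inC (j : ℕ) : BForm := .and (aV j) (.neg (bV j))
def zeroF (j : ℕ) : BForm := .boxP1 (.neg (inC j))
def leaveF (j : ℕ) : BForm := .and (inC j) (.box0 (bV j))
def noleaveF (j : ℕ) : BForm := .boxP1 (.neg (leaveF j))
def le1F (j : ℕ) : BForm := .boxP1 (.imp (leaveF j) (.box1 (.neg (leaveF j))))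
def enterF (j : ℕ) : BForm :=
  diaP1 (.and (.neg (aV j)) (.and (.box0 (aV j)) (.dia0 (.neg (bV j)))))
def nextF (φ : BForm) : BForm := diaP1 (.and (.neg (.dia0 (.dia0 nV))) (.dia0 (.and nV φ)))

def headF (op : CMOp) : BForm :=
  Sum.casesOn op (fun _ => BForm.top)
    (fun op' => Sum.casesOn op' (fun i => enterF (i+1)) (fun i => zeroF (i+1)))

def opF (N : ℕ) (op : CMOp) : BForm :=
  .and (headF op)
    (conjF (List.range N) fun j => if op = Sum.inl j then le1F (j+1) else noleaveF (j+1))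

def tranF (N q : ℕ) (t : ℕ × CMOp × ℕ) : BForm :=
  if t.2.2 = q then .and (opF N t.2.1) (nextF (qV t.1)) else BForm.bot

def bodyF (p : CMDesc × ℕ × ℕ) (q : ℕ) : BForm :=
  .and
    (.imp eV (.and (.and (noleaveF 0) (enterF 0))
      (if q = p.2.1 then conjF (List.range p.1.1) (fun j => zeroF (j+1)) else BForm.bot)))
    (.imp (.neg eV) (.and
      (orF (noleaveF 0) (if q = p.2.2 then .and (le1F 0) (enterF 0) else BForm.bot))
      (disjF p.1.2.2.2 (tranF p.1.1 q))))

def persF (j : ℕ) : BForm := .and (.imp (aV j) (.box0 (aV j))) (.imp (bV j) (.box0 (bV j)))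

def statesL (p : CMDesc × ℕ × ℕ) : List ℕ := List.range (p.1.2.1 + p.2.1 + 1)

def mainF (p : CMDesc × ℕ × ℕ) : BForm :=
  .boxP0 (.boxP1
    (.and (.dia0 eV)
    (.and (.imp eV (.box1 eV))
    (.and (conjF (List.range (p.1.1 + 1)) persF)
    (.and (.imp (.and eV (inC 0)) (.box0 (.imp eV (.neg (inC 0)))))
    (.and (disjF (statesL p) qV)
      (conjF (statesL p) (fun q => .imp (qV q) (bodyF p q)))))))))

/-! ## Simplified semantics -/

def ESat {V : Type} (D : ℕ → Set V) (val : ℕ → ℕ → V → Prop) : ℕ → V → BForm → Prop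
  | m, u, .var n => val n m u
  | m, u, .neg φ => ¬ ESat D val m u φ
  | m, u, .and φ ψ => ESat D val m u φ ∧ ESat D val m u ψ
  | m, u, .dia0 φ => ∃ m', m < m' ∧ ESat D val m' u φ
  | m, u, .dia1 φ => ∃ u', u' ∈ D m ∧ u ≠ u' ∧ ESat D val m u' φ

theorem esat_of_sat {φ : BForm} (h : ExpDiffSat IsOmegaFrame φ) :
    ∃ (V : Type) (D : ℕ → Set V) (val : ℕ → ℕ → V → Prop) (m : ℕ) (u : V),
      Monotone D ∧ u ∈ D m ∧ ESat D val m u φ := by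
  obtain ⟨T, ⟨e, he⟩, hexp, hdiff, val, w, hw⟩ := h
  change T.H ≃ ℕ at e
  change ∀ a b, T.R a b ↔ e a < e b at he
  refine ⟨T.V, fun n => T.D (e.symm n), fun k n v => ∃ h, val k ⟨(e.symm n, v), h⟩,
    e w.1.1, w.1.2, ?_, by simpa using w.2, ?_⟩
  · intro a b hab
    rcases hab.eq_or_lt with rfl | hlt
    · exact le_rfl
    · exact (hexp _ _ ((he _ _).2 (by simpa using hlt))).1
  · revert hw
    suffices ∀ (φ : BForm) w, BSat T.Rh T.Rv val w φ ↔ ESat (fun n => T.D (e.symm n))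
        (fun k n v => ∃ h, val k ⟨(e.symm n, v), h⟩) (e w.1.1) w.1.2 φ from (this φ w).1
    intro φ
    induction φ with
    | var n =>
      rintro ⟨⟨a, b⟩, hw⟩
      simp only [BSat, ESat, Equiv.symm_apply_apply]
      exact ⟨fun h => ⟨hw, h⟩, fun ⟨_, h⟩ => h⟩
    | neg φ ih => intro w; simp only [BSat, ESat, ih]
    | and φ ψ ih1 ih2 => intro w; simp only [BSat, ESat, ih1, ih2]
    | dia0 φ ih =>
      rintro ⟨⟨a, b⟩, hw⟩
      simp only [BSat, ESat, ih]
      constructor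
      · rintro ⟨⟨⟨a', b'⟩, hv⟩, ⟨h1, h2⟩, h3⟩
        simp only at h1 h2 h3
        subst h2
        exact ⟨e a', (he _ _).1 h1, h3⟩
      · rintro ⟨m', h1, h2⟩
        have hR : T.R a (e.symm m') := (he _ _).2 (by simpa using h1)
        exact ⟨⟨(e.symm m', b), (hexp _ _ hR).1 hw⟩, ⟨hR, rfl⟩, by simpa using h2⟩
    | dia1 φ ih =>
      rintro ⟨⟨a, b⟩, hw⟩
      simp only [BSat, ESat, ih]
      constructor
      · rintro ⟨⟨⟨a', b'⟩, hv⟩, ⟨h1, h2⟩, h3⟩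
        simp only at h1 h2 h3 hv
        subst h1
        exact ⟨b', by simpa using hv, (hdiff _ _ hw _ hv).1 h2, h3⟩
      · rintro ⟨b', h1, h2, h3⟩
        have h1' : b' ∈ T.D a := by simpa using h1
        exact ⟨⟨(a, b'), h1'⟩, ⟨rfl, (hdiff _ _ hw _ h1').2 h2⟩, h3⟩

/-- The constant-domain frame over `⟨ω,<⟩`. -/
def constFrame (V : Type) (u : V) : TwoFrame :=
  ⟨ℕ, (· < ·), ⟨0⟩, V, fun _ => Set.univ, fun _ => (· ≠ ·), fun _ => ⟨u, trivial⟩⟩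

theorem sat_of_esat {φ : BForm} {V : Type} (val : ℕ → ℕ → V → Prop) (u : V)
    (h : ESat (fun _ => Set.univ) val 0 u φ) : ExpDiffSat IsOmegaFrame φ := by
  refine ⟨constFrame V u,
    ⟨Equiv.refl ℕ, fun _ _ => Iff.rfl⟩, fun _ _ _ => ⟨le_rfl, fun _ _ _ _ => Iff.rfl⟩,
    fun _ _ _ _ _ => Iff.rfl, fun k w => val k w.1.1 w.1.2, ⟨((0 : ℕ), u), trivial⟩, ?_⟩
  suffices ∀ (φ : BForm) (w : (constFrame V u).Worlds), ESat (fun _ => Set.univ) val w.1.1 w.1.2 φ ↔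
    BSat (constFrame V u).Rh (constFrame V u).Rv (fun k w => val k w.1.1 w.1.2) w φ from
    (this φ ⟨((0 : ℕ), u), trivial⟩).1 h
  intro φ
  induction φ with
  | var n => intro w; simp only [BSat, ESat]
  | neg φ ih => intro w; simp only [BSat, ESat, ih]
  | and φ ψ ih1 ih2 => intro w; simp only [BSat, ESat, ih1, ih2]
  | dia0 φ ih =>
    rintro ⟨⟨a, b⟩, hw⟩
    simp only [BSat, ESat, ← ih]
    constructor
    · rintro ⟨m', h1, h2⟩
      exact ⟨⟨(m', b), trivial⟩, ⟨h1, rfl⟩, h2⟩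
    · rintro ⟨⟨⟨a', b'⟩, hv⟩, ⟨h1, h2⟩, h3⟩
      simp only at h1 h2 h3
      subst h2
      exact ⟨a', h1, h3⟩
  | dia1 φ ih =>
    rintro ⟨⟨a, b⟩, hw⟩
    simp only [BSat, ESat, ← ih]
    constructor
    · rintro ⟨b', -, h2, h3⟩
      exact ⟨⟨(a, b'), trivial⟩, ⟨rfl, h2⟩, h3⟩
    · rintro ⟨⟨⟨a', b'⟩, hv⟩, ⟨h1, h2⟩, h3⟩
      simp only at h1 h2 h3
      subst h1
      exact ⟨b', trivial, h2, h3⟩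

section sem
variable {V : Type} {D : ℕ → Set V} {val : ℕ → ℕ → V → Prop} {m : ℕ} {u : V}

theorem es_var {n : ℕ} : ESat D val m u (.var n) ↔ val n m u := Iff.rfl
theorem es_neg {φ : BForm} : ESat D val m u (.neg φ) ↔ ¬ ESat D val m u φ := Iff.rfl
theorem es_and {φ ψ : BForm} :
    ESat D val m u (.and φ ψ) ↔ ESat D val m u φ ∧ ESat D val m u ψ := Iff.rfl
theorem es_dia0 {φ : BForm} :
    ESat D val m u (.dia0 φ) ↔ ∃ m', m < m' ∧ ESat D val m' u φ := Iff.rfl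
theorem es_box0 {φ : BForm} :
    ESat D val m u (.box0 φ) ↔ ∀ m', m < m' → ESat D val m' u φ := by
  simp [BForm.box0, ESat]
theorem es_box1 {φ : BForm} :
    ESat D val m u (.box1 φ) ↔ ∀ u' ∈ D m, u ≠ u' → ESat D val m u' φ := by
  simp [BForm.box1, ESat]
theorem es_imp {φ ψ : BForm} :
    ESat D val m u (.imp φ ψ) ↔ (ESat D val m u φ → ESat D val m u ψ) := by
  simp [BForm.imp, ESat]
theorem es_bot : ESat D val m u BForm.bot ↔ False := by
  simp [BForm.bot, ESat]
theorem es_top : ESat D val m u BForm.top ↔ True := by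
  simp [BForm.top, BForm.bot, ESat]
theorem es_or {φ ψ : BForm} :
    ESat D val m u (orF φ ψ) ↔ ESat D val m u φ ∨ ESat D val m u ψ := by
  simp [orF, ESat]; tauto
theorem es_conj {β : Type} {l : List β} {f : β → BForm} :
    ESat D val m u (conjF l f) ↔ ∀ b ∈ l, ESat D val m u (f b) := by
  induction l with
  | nil => simp [conjF, es_top]
  | cons a l ih =>
    have : conjF (a :: l) f = .and (f a) (conjF l f) := rfl
    simp [this, es_and, ih]
theorem es_disj {β : Type} {l : List β} {f : β → BForm} :
    ESat D val m u (disjF l f) ↔ ∃ b ∈ l, ESat D val m u (f b) := by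
  induction l with
  | nil => simp [disjF, es_bot]
  | cons a l ih =>
    have : disjF (a :: l) f = orF (f a) (disjF l f) := rfl
    simp [this, es_or, ih]
theorem es_boxP0 {φ : BForm} :
    ESat D val m u (.boxP0 φ) ↔ ∀ m', m ≤ m' → ESat D val m' u φ := by
  rw [BForm.boxP0, es_and, es_box0]
  constructor
  · rintro ⟨h1, h2⟩ m' hm
    rcases hm.eq_or_lt with rfl | h
    · exact h1
    · exact h2 _ h
  · exact fun h => ⟨h m le_rfl, fun m' hm => h m' hm.le⟩
theorem es_boxP1 {φ : BForm} (hu : u ∈ D m) :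
    ESat D val m u (.boxP1 φ) ↔ ∀ u' ∈ D m, ESat D val m u' φ := by
  rw [BForm.boxP1, es_and, es_box1]
  constructor
  · rintro ⟨h1, h2⟩ u' hu'
    by_cases h : u = u'
    · exact h ▸ h1
    · exact h2 _ hu' h
  · exact fun h => ⟨h u hu, fun u' hu' _ => h u' hu'⟩
theorem es_diaP1 {φ : BForm} (hu : u ∈ D m) :
    ESat D val m u (diaP1 φ) ↔ ∃ u' ∈ D m, ESat D val m u' φ := by
  rw [diaP1, es_or, ESat]
  constructor
  · rintro (h | ⟨u', h1, -, h2⟩)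
    · exact ⟨u, hu, h⟩
    · exact ⟨u', h1, h2⟩
  · rintro ⟨u', h1, h2⟩
    by_cases h : u = u'
    · exact Or.inl (h ▸ h2)
    · exact Or.inr ⟨u', h1, h, h2⟩
end sem
end partA2

section partA3
section snd
variable {V : Type} {D : ℕ → Set V} {val : ℕ → ℕ → V → Prop}

/-- the elements of counter `j` at time `m` -/
def cSet (D : ℕ → Set V) (val : ℕ → ℕ → V → Prop) (j m : ℕ) : Set V :=
  {x | x ∈ D m ∧ val (3*j+3) m x ∧ ¬ val (3*j+4) m x}

theorem es_inC {j m : ℕ} {u : V} :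
    ESat D val m u (inC j) ↔ val (3*j+3) m u ∧ ¬ val (3*j+4) m u := Iff.rfl

theorem es_leave {j m : ℕ} {u : V} : ESat D val m u (leaveF j) ↔
    (val (3*j+3) m u ∧ ¬ val (3*j+4) m u) ∧ ∀ m', m < m' → val (3*j+4) m' u := by
  rw [leaveF, es_and, es_box0]; rfl

theorem stay (hD : Monotone D) {j m : ℕ}
    (hp : ∀ m', m ≤ m' → ∀ x ∈ D m', ESat D val m' x (persF j))
    {x : V} (hx : x ∈ cSet D val j m) (hl : ¬ ESat D val m x (leaveF j)) :
    x ∈ cSet D val j (m+1) := by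
  obtain ⟨hxD, hA, hB⟩ := hx
  have hxD' := hD (Nat.le_succ m) hxD
  have h1 := hp m le_rfl x hxD
  have h2 := hp (m+1) (Nat.le_succ m) x hxD'
  rw [persF, es_and, es_imp, es_imp, es_box0, es_box0] at h1 h2
  rw [es_leave] at hl
  push Not at hl
  obtain ⟨m', hm', hB'⟩ := hl ⟨hA, hB⟩
  refine ⟨hxD', h1.1 hA _ (Nat.lt_succ_self m), fun hB2 => hB' ?_⟩
  rcases (Nat.succ_le_of_lt hm').eq_or_lt with h | h
  · exact h ▸ hB2
  · exact h2.2 hB2 _ h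

theorem noleave_sub (hD : Monotone D) {j m : ℕ}
    (hp : ∀ m', m ≤ m' → ∀ x ∈ D m', ESat D val m' x (persF j))
    {u : V} (hu : u ∈ D m) (h : ESat D val m u (noleaveF j)) :
    cSet D val j m ⊆ cSet D val j (m+1) := by
  rw [noleaveF, es_boxP1 hu] at h
  exact fun x hx => stay hD hp hx (h x hx.1)

theorem le1_sub (hD : Monotone D) {j m : ℕ}
    (hp : ∀ m', m ≤ m' → ∀ x ∈ D m', ESat D val m' x (persF j))
    {u : V} (hu : u ∈ D m) (h : ESat D val m u (le1F j)) :
    ∃ y, cSet D val j m ⊆ insert y (cSet D val j (m+1)) := by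
  rw [le1F, es_boxP1 hu] at h
  by_cases hy : ∃ y ∈ D m, ESat D val m y (leaveF j)
  · obtain ⟨y, hyD, hy⟩ := hy
    refine ⟨y, fun x hx => ?_⟩
    by_cases hxy : y = x
    · exact Or.inl hxy.symm
    · have := h y hyD
      rw [es_imp, es_box1] at this
      exact Or.inr (stay hD hp hx (this hy x hx.1 hxy))
  · push Not at hy
    exact ⟨u, fun x hx => Or.inr (stay hD hp hx (hy x hx.1))⟩

theorem enter_ex (hD : Monotone D) {j m : ℕ}
    (hp : ∀ m', m ≤ m' → ∀ x ∈ D m', ESat D val m' x (persF j))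
    {u : V} (hu : u ∈ D m) (h : ESat D val m u (enterF j)) :
    ∃ x, x ∉ cSet D val j m ∧ x ∈ cSet D val j (m+1) := by
  rw [enterF, es_diaP1 hu] at h
  obtain ⟨x, hx, h⟩ := h
  rw [es_and, es_and, es_box0, es_dia0] at h
  obtain ⟨h1, h2, m', hm', h3⟩ := h
  have hxD' := hD (Nat.le_succ m) hx
  refine ⟨x, fun hx' => h1 hx'.2.1, hxD', h2 _ (Nat.lt_succ_self m), fun hB => h3 ?_⟩
  have := hp (m+1) (Nat.le_succ m) x hxD'
  rw [persF, es_and, es_imp, es_imp, es_box0, es_box0] at this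
  rcases (Nat.succ_le_of_lt hm').eq_or_lt with h | h
  · exact h ▸ hB
  · exact this.2 hB _ h

theorem zero_empty {j m : ℕ} {u : V} (hu : u ∈ D m) (h : ESat D val m u (zeroF j)) :
    cSet D val j m = ∅ := by
  rw [zeroF, es_boxP1 hu] at h
  ext x
  simp only [Set.mem_empty_iff_false, iff_false]
  exact fun hx => h x hx.1 hx.2

theorem next_ex {m : ℕ} {u : V} {φ : BForm} (hu : u ∈ D m) (h : ESat D val m u (nextF φ)) :
    ∃ x ∈ D m, ESat D val (m+1) x φ := by
  rw [nextF, es_diaP1 hu] at h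
  obtain ⟨x, hx, h⟩ := h
  rw [es_and, es_neg, es_dia0, es_dia0] at h
  obtain ⟨h1, m', hm', h2, h3⟩ := h
  refine ⟨x, hx, ?_⟩
  rcases (Nat.succ_le_of_lt hm').eq_or_lt with h | h
  · subst h
    exact h3
  · exact absurd ⟨m+1, Nat.lt_succ_self m, m', h, h2⟩ h1

theorem toEnc {p : CMDesc × ℕ × ℕ} (hM : CMWF p.1) (hD : Monotone D) {m0 : ℕ} {u0 : V}
    (hu0 : u0 ∈ D m0) (h : ESat D val m0 u0 (mainF p)) :
    Nonempty (Enc p.1 p.2.1 p.2.2 V) := by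
  have H : ∀ m, m0 ≤ m → ∀ u ∈ D m, _ := fun m hm u hu =>
    (es_boxP1 (hD hm hu0)).1 ((es_boxP0.1 h) m hm) u hu
  simp only [es_and, es_imp, es_conj, es_box1, es_dia0, es_disj, es_box0] at H
  have hp : ∀ j < p.1.1 + 1, ∀ m, m0 ≤ m → ∀ m', m ≤ m' → ∀ x ∈ D m', ESat D val m' x (persF j) :=
    fun j hj m hm m' hm' x hx => (H m' (hm.trans hm') x hx).2.2.1 j (List.mem_range.2 hj)
  have hu : ∀ m, u0 ∈ D (m0 + m) := fun m => hD (Nat.le_add_right _ _) hu0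
  have hE : ∀ m, m0 ≤ m → ∀ x ∈ D m, ∀ y ∈ D m, val 1 m x → val 1 m y := by
    intro m hm x hx y hy h1
    by_cases hxy : x = y
    · exact hxy ▸ h1
    · exact (H m hm x hx).2.1 h1 y hy hxy
  have hbody : ∀ m q, (q ∈ statesL p ∧ ∃ u ∈ D (m0+m), val (3*q+2) (m0+m) u) →
      ∃ u ∈ D (m0+m), ESat D val (m0+m) u (bodyF p q) := by
    rintro m q ⟨hq, u, hu, hv⟩
    exact ⟨u, hu, (H _ (Nat.le_add_right _ _) u hu).2.2.2.2.2 q hq hv⟩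
  refine ⟨⟨fun m => ∃ u ∈ D (m0+m), val 1 (m0+m) u,
    fun q m => q ∈ statesL p ∧ ∃ u ∈ D (m0+m), val (3*q+2) (m0+m) u,
    fun j m => cSet D val j (m0+m), ?_, ?_, ?_, ?_, ?_, ?_, ?_⟩⟩
  · intro m
    obtain ⟨m', hm', h1⟩ := (H (m0+m) (Nat.le_add_right _ _) u0 (hu m)).1
    obtain ⟨d, rfl⟩ := Nat.exists_eq_add_of_lt hm'
    exact ⟨m + d + 1, by omega, u0, hu _, by
      have e : m0 + (m+d+1) = m0+m+d+1 := by omega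
      rw [e]; exact h1⟩
  · rintro m ⟨u, hu', hv⟩
    obtain ⟨q, hq, hqv⟩ := (H (m0+m) (Nat.le_add_right _ _) u hu').2.2.2.2.1
    have hb := (H _ (Nat.le_add_right _ _) u hu').2.2.2.2.2 q hq hqv
    rw [bodyF, es_and, es_imp, es_imp, es_and, es_and] at hb
    obtain ⟨⟨h1, h2⟩, -⟩ := hb.1 hv
    have hp0 := hp 0 (by omega) (m0+m) (Nat.le_add_right _ _)
    exact ⟨noleave_sub hD hp0 hu' h1, enter_ex hD hp0 hu' h2⟩
  · rintro m m' hmm ⟨u, hu1, hv⟩ ⟨u', hu2, hv'⟩ x hx hx'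
    have hx1 := hE _ (Nat.le_add_right _ _) u hu1 x hx.1 hv
    have hx2 := hE _ (Nat.le_add_right _ _) u' hu2 x hx'.1 hv'
    exact (H (m0+m) (Nat.le_add_right _ _) x hx.1).2.2.2.1 ⟨hx1, hx.2⟩ (m0+m') (by omega) hx2 hx'.2
  · intro m
    obtain ⟨q, hq, hqv⟩ := (H (m0+m) (Nat.le_add_right _ _) u0 (hu m)).2.2.2.2.1
    exact ⟨q, hq, u0, hu m, hqv⟩
  · rintro m q hQ ⟨u', hu', hv'⟩
    obtain ⟨u, hu1, hb⟩ := hbody m q hQ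
    rw [bodyF, es_and, es_imp, es_imp, es_and, es_and] at hb
    have h1 := (hb.1 (hE _ (Nat.le_add_right _ _) u' hu' u hu1 hv')).2
    split_ifs at h1 with hq
    · refine ⟨hq, fun j hj => zero_empty hu1 ?_⟩
      rw [es_conj] at h1
      exact h1 j (List.mem_range.2 hj)
    · exact (es_bot.1 h1).elim
  · rintro m q hQ hnE
    obtain ⟨u, hu1, hb⟩ := hbody m q hQ
    rw [bodyF, es_and, es_imp, es_imp, es_and, es_and] at hb
    have h1 := hb.2 (fun h => hnE ⟨u, hu1, h⟩)
    rw [es_and, es_or] at h1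
    have hp0 := hp 0 (by omega) (m0+m) (Nat.le_add_right _ _)
    rcases h1.1 with h2 | h2
    · exact Or.inl (noleave_sub hD hp0 hu1 h2)
    · split_ifs at h2 with hq
      · rw [es_and] at h2
        exact Or.inr ⟨hq, le1_sub hD hp0 hu1 h2.1, enter_ex hD hp0 hu1 h2.2⟩
      · exact (es_bot.1 h2).elim
  · rintro m q hQ hnE
    obtain ⟨u, hu1, hb⟩ := hbody m q hQ
    rw [bodyF, es_and, es_imp, es_imp, es_and, es_and] at hb
    have h1 := hb.2 (fun h => hnE ⟨u, hu1, h⟩)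
    rw [es_and, es_disj] at h1
    obtain ⟨-, t, ht, h2⟩ := h1
    rw [tranF] at h2
    split_ifs at h2 with hq
    swap
    · exact (es_bot.1 h2).elim
    rw [es_and, opF, es_and, es_conj] at h2
    obtain ⟨⟨h3, h4⟩, h5⟩ := h2
    have hwf := hM.2.2.1 t ht
    have hpj : ∀ j < p.1.1, _ := fun j hj => hp (j+1) (by omega) (m0+m) (Nat.le_add_right _ _)
    obtain ⟨x, hx, hx2⟩ := next_ex hu1 h5
    refine ⟨t, ht, hq, ⟨?_, x, hD (by omega) hx, hx2⟩, ?_, ?_, ?_⟩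
    · have := hwf.1
      rw [statesL, List.mem_range]; omega
    · intro j hj
      have h6 := h4 j (List.mem_range.2 hj)
      split_ifs with h7
      · rw [if_pos h7] at h6
        exact le1_sub hD (hpj j hj) hu1 h6
      · rw [if_neg h7] at h6
        exact noleave_sub hD (hpj j hj) hu1 h6
    · intro i hi
      rw [hi] at h3
      have hi' : i < p.1.1 := by have := hwf.2.2.2; rwa [hi] at this
      exact enter_ex hD (hpj i hi') hu1 h3
    · intro i hi
      rw [hi] at h3
      exact zero_empty hu1 h3
end snd

theorem soundness {p : CMDesc × ℕ × ℕ} (hM : CMWF p.1) (h : ExpDiffSat IsOmegaFrame (mainF p)) :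
    LCMOmegaReach p := by
  obtain ⟨V, D, val, m, u, hD, hu, hs⟩ := esat_of_sat h
  obtain ⟨S⟩ := toEnc hM hD hu hs
  exact S.reach hM
end partA3

section partA4
/-! ## Completeness of the formula -/

section compl
variable (ρ : ℕ → ℕ → CMConfig) (B : ℕ → ℕ) (qr : ℕ)

structure PSt where
  k : ℕ
  r : ℕ
  b : ℕ
  g : ℕ

def vis (k r : ℕ) : ℕ := if (ρ k r).1 = qr then 1 else 0
def cnt (k : ℕ) : ℕ → ℕ
  | 0 => 0
  | r+1 => cnt k r + vis ρ qr k (r+1)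

def pnext (s : PSt) : PSt :=
  match s with
  | ⟨k, 0, b, _⟩ => ⟨k+1, B (k+1), b, b+k+1⟩
  | ⟨k, r+1, b, g⟩ => ⟨k, r, b + vis ρ qr k (r+1), g⟩

def ppos : ℕ → PSt
  | 0 => ⟨0, B 0, 0, 0⟩
  | m+1 => pnext ρ B qr (ppos m)

def pcfg (m : ℕ) : CMConfig := ρ (ppos ρ B qr m).k (ppos ρ B qr m).r

def pbc (j : ℕ) : ℕ → ℕ
  | 0 => 0
  | m+1 => pbc j m + ((pcfg ρ B qr m).2 j - (pcfg ρ B qr (m+1)).2 j)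

def pb : ℕ → ℕ → ℕ
  | 0, m => (ppos ρ B qr m).b
  | j+1, m => pbc ρ B qr j m
def pa : ℕ → ℕ → ℕ
  | 0, m => (ppos ρ B qr m).b + (ppos ρ B qr m).k + 1
  | j+1, m => pbc ρ B qr j m + (pcfg ρ B qr m).2 j

def pval (n m y : ℕ) : Prop :=
  if n = 0 then y = m else if n = 1 then (ppos ρ B qr m).r = 0
  else if n % 3 = 2 then (pcfg ρ B qr m).1 = n / 3
  else if n % 3 = 0 then y < pa ρ B qr (n/3 - 1) m
  else y < pb ρ B qr (n/3 - 1) m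

variable {ρ B qr}

local notation "SS" => ESat (V := ℕ) (fun _ => Set.univ) (pval ρ B qr)
variable {m y : ℕ}

theorem pv_n : SS m y nV ↔ y = m := by simp [nV, es_var, pval]
theorem pv_e : SS m y eV ↔ (ppos ρ B qr m).r = 0 := by simp [eV, es_var, pval]
theorem pv_q {q : ℕ} : SS m y (qV q) ↔ (pcfg ρ B qr m).1 = q := by
  have h1 : (3*q+2) % 3 = 2 := by omega
  have h2 : (3*q+2) / 3 = q := by omega
  have h3 : 3*q+2 ≠ 1 := by omega
  simp [qV, es_var, pval, h1, h2, h3]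
theorem pv_a {j : ℕ} : SS m y (aV j) ↔ y < pa ρ B qr j m := by
  have h1 : (3*j+3) % 3 = 0 := by omega
  have h2 : (3*j+3) / 3 - 1 = j := by omega
  have h3 : 3*j+3 ≠ 1 := by omega
  simp only [aV, es_var, pval, h1, h2, h3]; simp
theorem pv_b {j : ℕ} : SS m y (bV j) ↔ y < pb ρ B qr j m := by
  have h1 : (3*j+4) % 3 = 1 := by omega
  have h2 : (3*j+4) / 3 - 1 = j := by omega
  have h3 : 3*j+4 ≠ 1 := by omega
  simp only [bV, es_var, pval, h1, h2, h3]; simp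

theorem pbc_mono (j : ℕ) : Monotone (pb ρ B qr j) := by
  apply monotone_nat_of_le_succ
  intro m
  cases j with
  | zero =>
    simp only [pb, ppos]
    rcases ppos ρ B qr m with ⟨k, _ | r, b, g⟩ <;> simp [pnext]
  | succ j => simp [pb, pbc]

theorem pac_mono (j : ℕ) : Monotone (pa ρ B qr j) := by
  apply monotone_nat_of_le_succ
  intro m
  cases j with
  | zero =>
    simp only [pa, ppos]
    rcases ppos ρ B qr m with ⟨k, _ | r, b, g⟩ <;> simp [pnext] <;> omega
  | succ j => simp only [pa, pbc]; omega

theorem pv_in {j : ℕ} : SS m y (inC j) ↔ pb ρ B qr j m ≤ y ∧ y < pa ρ B qr j m := by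
  rw [inC, es_and, es_neg, pv_a, pv_b, not_lt, and_comm]

theorem pv_zero {j : ℕ} (h : pa ρ B qr j m ≤ pb ρ B qr j m) : SS m y (zeroF j) := by
  rw [zeroF, es_boxP1 (by trivial)]
  intro u _
  rw [es_neg, pv_in]; omega

theorem pv_leave {j : ℕ} (h : SS m y (leaveF j)) : pb ρ B qr j m ≤ y ∧ y < pb ρ B qr j (m+1) := by
  rw [leaveF, es_and, pv_in, es_box0] at h
  exact ⟨h.1.1, pv_b.1 (h.2 (m+1) (Nat.lt_succ_self m))⟩

theorem pv_noleave {j : ℕ} (h : pb ρ B qr j (m+1) ≤ pb ρ B qr j m) : SS m y (noleaveF j) := by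
  rw [noleaveF, es_boxP1 (by trivial)]
  intro u _ hu
  have := pv_leave hu
  omega

theorem pv_le1 {j : ℕ} (h : pb ρ B qr j (m+1) ≤ pb ρ B qr j m + 1) : SS m y (le1F j) := by
  rw [le1F, es_boxP1 (by trivial)]
  intro u _
  rw [es_imp, es_box1]
  intro hu u' _ hne hu'
  have := pv_leave hu
  have := pv_leave hu'
  omega

theorem pv_enter {j : ℕ} (h1 : pa ρ B qr j m < pa ρ B qr j (m+1))
    (h2 : pb ρ B qr j (m+1) ≤ pa ρ B qr j m) : SS m y (enterF j) := by
  rw [enterF, es_diaP1 (by trivial)]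
  refine ⟨pa ρ B qr j m, trivial, ?_⟩
  rw [es_and, es_and, es_neg, pv_a, es_box0, es_dia0]
  refine ⟨lt_irrefl _, fun m' hm' => ?_, m+1, Nat.lt_succ_self m, ?_⟩
  · rw [pv_a]
    exact h1.trans_le (pac_mono j hm')
  · rw [es_neg, pv_b]; omega

theorem pv_next {φ : BForm} (h : SS (m+1) (m+1) φ) : SS m y (nextF φ) := by
  rw [nextF, es_diaP1 (by trivial)]
  refine ⟨m+1, trivial, ?_⟩
  rw [es_and, es_neg, es_dia0, es_dia0]
  refine ⟨?_, m+1, Nat.lt_succ_self m, ?_⟩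
  · rintro ⟨m', h1, h2⟩
    rw [es_dia0] at h2
    obtain ⟨m'', h2, h3⟩ := h2
    rw [pv_n] at h3
    omega
  · rw [es_and, pv_n]; exact ⟨rfl, h⟩

theorem pr_bound (m : ℕ) : (ppos ρ B qr m).r ≤ B (ppos ρ B qr m).k := by
  induction m with
  | zero => simp [ppos]
  | succ m ih =>
    simp only [ppos]
    revert ih
    rcases ppos ρ B qr m with ⟨k, _ | r, b, g⟩ <;> simp [pnext]
    omega

theorem pinv (hc : ∀ k, k ≤ cnt ρ qr k (B k)) (m : ℕ) :
    (ppos ρ B qr m).g ≤ (ppos ρ B qr m).b + cnt ρ qr (ppos ρ B qr m).k (ppos ρ B qr m).r := by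
  induction m with
  | zero => simp [ppos]
  | succ m ih =>
    simp only [ppos]
    revert ih
    rcases ppos ρ B qr m with ⟨k, _ | r, b, g⟩ <;> simp [pnext, cnt]
    · have := hc (k+1); omega
    · omega

theorem pg_mono (hc : ∀ k, k ≤ cnt ρ qr k (B k)) : Monotone (fun m => (ppos ρ B qr m).g) := by
  apply monotone_nat_of_le_succ
  intro m
  have := pinv hc m
  revert this
  simp only [ppos]
  rcases ppos ρ B qr m with ⟨k, _ | r, b, g⟩ <;> simp [pnext, cnt]
  omega

theorem pg_end (h : (ppos ρ B qr m).r = 0) : (ppos ρ B qr (m+1)).g = pa ρ B qr 0 m := by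
  simp only [ppos, pa]
  revert h
  rcases ppos ρ B qr m with ⟨k, _ | r, b, g⟩ <;> simp [pnext]

theorem prule (hc : ∀ k, k ≤ cnt ρ qr k (B k)) {m m' : ℕ} (hm : m < m')
    (h : (ppos ρ B qr m).r = 0) (h' : (ppos ρ B qr m').r = 0) :
    pa ρ B qr 0 m ≤ pb ρ B qr 0 m' := by
  rw [← pg_end h]
  have h1 := pinv hc m'
  rw [h', cnt] at h1
  exact (pg_mono hc hm).trans h1

theorem pr_ex (m : ℕ) : ∃ m', m < m' ∧ (ppos ρ B qr m').r = 0 := by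
  suffices ∀ r m, (ppos ρ B qr m).r = r → ∃ m', m ≤ m' ∧ (ppos ρ B qr m').r = 0 by
    obtain ⟨m', h1, h2⟩ := this _ (m+1) rfl
    exact ⟨m', h1, h2⟩
  intro r
  induction r with
  | zero => intro m h; exact ⟨m, le_rfl, h⟩
  | succ r ih =>
    intro m h
    obtain ⟨m', h1, h2⟩ := ih (m+1) (by
      simp only [ppos]
      revert h
      rcases ppos ρ B qr m with ⟨k, _ | r, b, g⟩ <;> simp [pnext])
    exact ⟨m', by omega, h2⟩
end compl

theorem cnt_eq (ρ : ℕ → ℕ → CMConfig) (qr k r : ℕ) :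
    ((Finset.range (r+1)).filter (fun n => (ρ k n).1 = qr)).card = cnt ρ qr k r + vis ρ qr k 0 := by
  induction r with
  | zero => simp [cnt, vis, Finset.filter_singleton]; split_ifs <;> rfl
  | succ r ih =>
    rw [Finset.range_add_one, Finset.filter_insert, cnt, vis]
    split_ifs with h
    · rw [Finset.card_insert_of_notMem (by simp), ih]; omega
    · rw [ih]; omega

theorem completeness {p : CMDesc × ℕ × ℕ} (h : LCMOmegaReach p) :
    ExpDiffSat IsOmegaFrame (mainF p) := by
  obtain ⟨hM, h⟩ := h
  choose B ρ h0 hst hk using fun k => h (k+1)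
  obtain ⟨M, q0, qr⟩ := p
  simp only at hM h0 hst hk
  have hc : ∀ k, k ≤ cnt ρ qr k (B k) := by
    intro k
    have := hk k
    rw [cnt_eq] at this
    have h2 : vis ρ qr k 0 ≤ 1 := by unfold vis; split_ifs <;> simp
    omega
  refine sat_of_esat (pval ρ B qr) 0 ?_
  rw [mainF, es_boxP0]
  intro m _
  rw [es_boxP1 (by trivial)]
  intro y _
  have hstate : (pcfg ρ B qr m).1 ∈ statesL (M, q0, qr) := by
    rw [statesL, List.mem_range]
    simp only
    unfold pcfg
    have hb := pr_bound (ρ := ρ) (B := B) (qr := qr) m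
    generalize ppos ρ B qr m = s at hb
    rcases s with ⟨k, _ | r, b, g⟩
    · simp only [h0, zeroConfig]; omega
    · obtain ⟨c1, c2, ⟨op, q', ht, e, -⟩, -⟩ := hst k r hb
      simp only at e ht ⊢
      rw [e]
      have := (hM.2.2.1 _ ht).2.2.1
      simp only at this
      omega
  simp only [es_and, es_imp, es_conj, es_box1, es_disj, es_box0, es_neg, es_dia0, pv_e]
  refine ⟨pr_ex m, fun h _ _ _ => h, ?_, ?_, ?_, ?_⟩
  · intro j _
    rw [persF, es_and, es_imp, es_imp, es_box0, es_box0]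
    simp only [pv_a, pv_b]
    exact ⟨fun h m' hm => h.trans_le (pac_mono j hm.le), fun h m' hm => h.trans_le (pbc_mono j hm.le)⟩
  · rintro ⟨h1, h2⟩ m' hm h3
    rw [pv_in] at h2 ⊢
    have := prule hc hm h1 h3
    omega
  · exact ⟨_, hstate, pv_q.2 rfl⟩
  · intro q _ hq
    rw [pv_q] at hq
    rw [bodyF, es_and, es_imp, es_imp, es_neg, pv_e]
    constructor
    · intro hr
      have hcf : pcfg ρ B qr m = zeroConfig q0 := by rw [pcfg, hr, h0]
      rw [es_and, es_and]
      have h1 : pb ρ B qr 0 (m+1) = pb ρ B qr 0 m := by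
        simp only [pb, ppos]; revert hr
        rcases ppos ρ B qr m with ⟨k, _ | r, b, g⟩ <;> simp [pnext]
      have h2 : pa ρ B qr 0 (m+1) = pa ρ B qr 0 m + 1 := by
        simp only [pa, ppos]; revert hr
        rcases ppos ρ B qr m with ⟨k, _ | r, b, g⟩ <;> simp [pnext]
        omega
      refine ⟨⟨pv_noleave h1.le, pv_enter (by omega) ?_⟩, ?_⟩
      · rw [h1]; simp only [pa, pb]; omega
      · rw [if_pos (by rw [← hq, hcf]; rfl), es_conj]
        intro j _
        apply pv_zero
        simp [pa, pb, hcf, zeroConfig]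
    · intro hr
      rw [es_and, es_or, es_disj]
      constructor
      · by_cases hv : q = qr
        · right
          rw [if_pos hv, es_and]
          have h1 : pb ρ B qr 0 (m+1) = pb ρ B qr 0 m + 1 ∧
              pa ρ B qr 0 (m+1) = pa ρ B qr 0 m + 1 := by
            simp only [pb, pa, ppos]
            rw [pcfg] at hq
            revert hr hq
            rcases ppos ρ B qr m with ⟨k, _ | r, b, g⟩ <;> simp [pnext]
            intro hq
            simp [vis, hq, hv]
            omega
          refine ⟨pv_le1 h1.1.le, pv_enter (by omega) ?_⟩
          rw [h1.1]; simp only [pb, pa]; omega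
        · left
          apply pv_noleave
          simp only [pb, ppos]
          rw [pcfg] at hq
          revert hr hq
          rcases ppos ρ B qr m with ⟨k, _ | r, b, g⟩ <;> simp [pnext]
          intro hq
          simp [vis, hq, hv]
      · have hstep : CMStepLossy M (pcfg ρ B qr (m+1)) (pcfg ρ B qr m) := by
          have hb := pr_bound (ρ := ρ) (B := B) (qr := qr) m
          simp only [pcfg, ppos]
          revert hr hb
          rcases ppos ρ B qr m with ⟨k, _ | r, b, g⟩ <;> simp [pnext]
          exact fun hr => hst k r hr
        obtain ⟨c1, c2, ⟨op, q', ht, e, hop⟩, hc1, hc2⟩ := hstep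
        refine ⟨_, ht, ?_⟩
        simp only at e ht hop
        rw [tranF, if_pos (by rw [← e, hq]), es_and, opF, es_and, es_conj]
        have hpb : ∀ j, pb ρ B qr (j+1) (m+1) = pb ρ B qr (j+1) m +
            ((pcfg ρ B qr m).2 j - (pcfg ρ B qr (m+1)).2 j) := fun j => rfl
        have hpa : ∀ j m, pa ρ B qr (j+1) m = pb ρ B qr (j+1) m + (pcfg ρ B qr m).2 j :=
          fun j m => rfl
        refine ⟨⟨?_, ?_⟩, pv_next (pv_q.2 rfl)⟩
        · rcases op with i | i | i
          · exact es_top.2 trivial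
          · have := hop.2.1
            have h1 := hc1 i
            have h2 := hc2 i
            apply pv_enter
            · rw [hpa, hpa, hpb]; omega
            · rw [hpa, hpb]; omega
          · have := hop.1
            have := hop.2 i
            have h1 := hc1 i
            have h2 := hc2 i
            apply pv_zero
            rw [hpa]; omega
        · intro j _
          have h1 := hc1 j
          have h2 := hc2 j
          split_ifs with hj
          · subst hj
            have := hop.1
            apply pv_le1
            rw [hpb]; omega
          · apply pv_noleave
            rw [hpb]
            rcases op with i | i | i
            · have := hop.2 j (fun h => hj (by rw [h]))
              omega
            · by_cases hji : j = i
              · subst hji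
                have := hop.2.1
                omega
              · have := hop.2.2 j hji
                omega
            · have := hop.2 j
              omega
end partA4

section partA5
/-! ## Computability of the reduction -/

section prim
variable {α β : Type} [Primcodable α] [Primcodable β]

theorem pp_forall {l : α → List β} {R : α → β → Prop} (hl : Primrec l)
    (hR : PrimrecPred (fun x : α × β => R x.1 x.2)) : PrimrecPred (fun a => ∀ b ∈ l a, R a b) := by
  have h : PrimrecRel (fun (b : β) (a : α) => R a b) :=
    PrimrecPred.comp hR (Primrec.pair Primrec.snd Primrec.fst)
  exact PrimrecRel.comp h.forall_mem_list hl Primrec.id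

theorem pp_exists {l : α → List β} {R : α → β → Prop} (hl : Primrec l)
    (hR : PrimrecPred (fun x : α × β => R x.1 x.2)) : PrimrecPred (fun a => ∃ b ∈ l a, R a b) := by
  have h : PrimrecRel (fun (b : β) (a : α) => R a b) :=
    PrimrecPred.comp hR (Primrec.pair Primrec.snd Primrec.fst)
  exact PrimrecRel.comp h.exists_mem_list hl Primrec.id

theorem pp_mem {l : α → List β} {f : α → β} [DecidableEq β] (hl : Primrec l) (hf : Primrec f) :
    PrimrecPred (fun a => f a ∈ l a) := by
  have := pp_exists (R := fun a b => b = f a) hl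
    (Primrec.eq.comp Primrec.snd (hf.comp Primrec.fst))
  exact this.of_eq (fun a => by simp)

structure PF (f : α → BForm) : Prop where
  prim : Primrec (fun a => encodeB (f a))

theorem PF.neg {f : α → BForm} (hf : PF f) : PF (fun a => .neg (f a)) :=
  ⟨Primrec₂.natPair.comp (Primrec.const 1) hf.prim⟩
theorem PF.dia0 {f : α → BForm} (hf : PF f) : PF (fun a => .dia0 (f a)) :=
  ⟨Primrec₂.natPair.comp (Primrec.const 3) hf.prim⟩
theorem PF.dia1 {f : α → BForm} (hf : PF f) : PF (fun a => .dia1 (f a)) :=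
  ⟨Primrec₂.natPair.comp (Primrec.const 4) hf.prim⟩
theorem PF.and {f g : α → BForm} (hf : PF f) (hg : PF g) : PF (fun a => .and (f a) (g a)) :=
  ⟨Primrec₂.natPair.comp (Primrec.const 2) (Primrec₂.natPair.comp hf.prim hg.prim)⟩
theorem PF.var {f : α → ℕ} (hf : Primrec f) : PF (fun a => .var (f a)) :=
  ⟨Primrec₂.natPair.comp (Primrec.const 0) hf⟩
theorem PF.const (φ : BForm) : PF (fun _ : α => φ) := ⟨Primrec.const _⟩
theorem PF.comp {f : β → BForm} {g : α → β} (hf : PF f) (hg : Primrec g) : PF (fun a => f (g a)) :=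
  ⟨Primrec.comp (f := fun b => encodeB (f b)) hf.prim hg⟩
theorem PF.imp {f g : α → BForm} (hf : PF f) (hg : PF g) : PF (fun a => .imp (f a) (g a)) :=
  (hf.and hg.neg).neg
theorem PF.or {f g : α → BForm} (hf : PF f) (hg : PF g) : PF (fun a => orF (f a) (g a)) :=
  (hf.neg.and hg.neg).neg
theorem PF.box0 {f : α → BForm} (hf : PF f) : PF (fun a => .box0 (f a)) := hf.neg.dia0.neg
theorem PF.box1 {f : α → BForm} (hf : PF f) : PF (fun a => .box1 (f a)) := hf.neg.dia1.neg
theorem PF.boxP0 {f : α → BForm} (hf : PF f) : PF (fun a => .boxP0 (f a)) := hf.and hf.box0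
theorem PF.boxP1 {f : α → BForm} (hf : PF f) : PF (fun a => .boxP1 (f a)) := hf.and hf.box1
theorem PF.diaP1 {f : α → BForm} (hf : PF f) : PF (fun a => HK.diaP1 (f a)) := hf.or hf.dia1
theorem PF.ite {c : α → Prop} [DecidablePred c] {f g : α → BForm} (hc : PrimrecPred c)
    (hf : PF f) (hg : PF g) : PF (fun a => if c a then f a else g a) :=
  ⟨(Primrec.ite hc hf.prim hg.prim).of_eq (fun a => by
    by_cases h : c a <;> simp [h])⟩
theorem PF.conj {l : α → List β} {f : α → β → BForm} (hl : Primrec l)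
    (hf : PF (fun x : α × β => f x.1 x.2)) : PF (fun a => conjF (l a) (f a)) := by
  have := Primrec.list_foldr (σ := ℕ) (h := fun a (x : β × ℕ) =>
      Nat.pair 2 (Nat.pair (encodeB (f a x.1)) x.2)) hl (Primrec.const (encodeB BForm.top))
    (Primrec₂.natPair.comp (Primrec.const 2) (Primrec₂.natPair.comp
      (Primrec.comp (f := fun x : α × β => encodeB (f x.1 x.2)) hf.prim (Primrec.pair Primrec.fst (Primrec.fst.comp Primrec.snd)))
      (Primrec.snd.comp Primrec.snd)))
  refine ⟨this.of_eq (fun a => ?_)⟩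
  induction l a with
  | nil => rfl
  | cons b t ih => rw [List.foldr_cons, ih]; rfl
theorem PF.disj {l : α → List β} {f : α → β → BForm} (hl : Primrec l)
    (hf : PF (fun x : α × β => f x.1 x.2)) : PF (fun a => disjF (l a) (f a)) := by
  have := Primrec.list_foldr (σ := ℕ) (h := fun a (x : β × ℕ) =>
      Nat.pair 1 (Nat.pair 2 (Nat.pair (Nat.pair 1 (encodeB (f a x.1))) (Nat.pair 1 x.2))))
    hl (Primrec.const (encodeB BForm.bot))
    (Primrec₂.natPair.comp (Primrec.const 1) (Primrec₂.natPair.comp (Primrec.const 2)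
      (Primrec₂.natPair.comp
      (Primrec₂.natPair.comp (Primrec.const 1)
        (Primrec.comp (f := fun x : α × β => encodeB (f x.1 x.2)) hf.prim (Primrec.pair Primrec.fst (Primrec.fst.comp Primrec.snd))))
      (Primrec₂.natPair.comp (Primrec.const 1) (Primrec.snd.comp Primrec.snd)))))
  refine ⟨this.of_eq (fun a => ?_)⟩
  induction l a with
  | nil => rfl
  | cons b t ih => rw [List.foldr_cons, ih]; rfl
end prim

theorem encodeB_inj : Function.Injective encodeB := by
  intro φ
  induction φ with
  | var n => intro ψ h; cases ψ <;> simp [encodeB, Nat.pair_eq_pair] at h ⊢; exact h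
  | neg φ ih => intro ψ h; cases ψ <;> simp [encodeB, Nat.pair_eq_pair] at h ⊢; exact ih h
  | and φ φ' ih ih' =>
    intro ψ h; cases ψ <;> simp [encodeB, Nat.pair_eq_pair] at h ⊢; exact ⟨ih h.1, ih' h.2⟩
  | dia0 φ ih => intro ψ h; cases ψ <;> simp [encodeB, Nat.pair_eq_pair] at h ⊢; exact ih h
  | dia1 φ ih => intro ψ h; cases ψ <;> simp [encodeB, Nat.pair_eq_pair] at h ⊢; exact ih h

theorem encodeB_ne (φ : BForm) : encodeB φ ≠ Nat.pair 5 0 := by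
  cases φ <;> simp [encodeB, Nat.pair_eq_pair]

section forms
open Primrec

theorem prim_lin (a b : ℕ) : Primrec (fun j : ℕ => a * j + b) :=
  nat_add.comp (nat_mul.comp (const a) Primrec.id) (const b)

theorem pf_q : PF qV := PF.var (prim_lin 3 2)
theorem pf_a : PF aV := PF.var (prim_lin 3 3)
theorem pf_b : PF bV := PF.var (prim_lin 3 4)
theorem pf_in : PF inC := pf_a.and pf_b.neg
theorem pf_zero : PF zeroF := pf_in.neg.boxP1
theorem pf_leave : PF leaveF := pf_in.and pf_b.box0
theorem pf_noleave : PF noleaveF := pf_leave.neg.boxP1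
theorem pf_le1 : PF le1F := (pf_leave.imp pf_leave.neg.box1).boxP1
theorem pf_enter : PF enterF := (pf_a.neg.and (pf_a.box0.and pf_b.neg.dia0)).diaP1
theorem PF.next {α : Type} [Primcodable α] {f : α → BForm} (hf : PF f) :
    PF (fun a => nextF (f a)) :=
  ((PF.const _).and ((PF.const _).and hf).dia0).diaP1
theorem pf_head : PF headF := by
  have : Primrec (fun op : CMOp => (Sum.casesOn op (fun _ => encodeB BForm.top)
    (fun op' => Sum.casesOn op' (fun i => encodeB (enterF (i+1)))
      (fun i => encodeB (zeroF (i+1)))) : ℕ)) := by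
    refine sumCasesOn Primrec.id (const _).to₂ ?_
    refine (sumCasesOn (f := fun x : CMOp × (ℕ ⊕ ℕ) => x.2)
      (g := fun _ i => encodeB (enterF (i+1))) (h := fun _ i => encodeB (zeroF (i+1))) snd ?_ ?_)
    · exact ((pf_enter.comp succ).comp snd).prim
    · exact ((pf_zero.comp succ).comp snd).prim
  exact ⟨this.of_eq (fun op => by rcases op with i | i | i <;> rfl)⟩

theorem pf_op : PF (fun x : ℕ × CMOp => opF x.1 x.2) := by
  refine (pf_head.comp snd).and ?_
  refine PF.conj (list_range.comp fst) (PF.ite ?_ ?_ ?_)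
  · exact Primrec.eq.comp (snd.comp fst) (sumInl.comp snd)
  · exact pf_le1.comp (succ.comp snd)
  · exact pf_noleave.comp (succ.comp snd)

theorem pf_tran : PF (fun x : (ℕ × ℕ) × (ℕ × CMOp × ℕ) => tranF x.1.1 x.1.2 x.2) := by
  refine PF.ite ?_ (PF.and ?_ (PF.next ?_)) (PF.const _)
  · exact Primrec.eq.comp (snd.comp (snd.comp snd)) (snd.comp fst)
  · exact pf_op.comp (pair (fst.comp fst) (fst.comp (snd.comp snd)))
  · exact pf_q.comp (fst.comp snd)

theorem pf_body : PF (fun x : (CMDesc × ℕ × ℕ) × ℕ => bodyF x.1 x.2) := by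
  have hN : Primrec (fun x : (CMDesc × ℕ × ℕ) × ℕ => x.1.1.1) := fst.comp (fst.comp fst)
  refine PF.and (PF.imp (PF.const _) (PF.and (PF.const _) (PF.ite ?_ (PF.conj ?_ ?_) (PF.const _))))
    (PF.imp (PF.const _) (PF.and (PF.or (PF.const _) (PF.ite ?_ (PF.const _) (PF.const _)))
      (PF.disj ?_ ?_)))
  · exact Primrec.eq.comp snd (fst.comp (snd.comp fst))
  · exact list_range.comp hN
  · exact pf_zero.comp (succ.comp snd)
  · exact Primrec.eq.comp snd (snd.comp (snd.comp fst))
  · exact snd.comp (snd.comp (snd.comp (fst.comp fst)))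
  · exact pf_tran.comp (pair (pair (hN.comp fst) (snd.comp fst)) snd)

theorem pf_pers : PF persF := (pf_a.imp pf_a.box0).and (pf_b.imp pf_b.box0)

theorem prim_states : Primrec statesL :=
  list_range.comp (succ.comp (nat_add.comp (fst.comp (snd.comp fst)) (fst.comp snd)))

theorem pf_main : PF mainF := by
  refine PF.boxP0 (PF.boxP1 (PF.and (PF.const _) (PF.and (PF.const _) (PF.and ?_
    (PF.and (PF.const _) (PF.and ?_ ?_))))))
  · exact PF.conj (list_range.comp (succ.comp (fst.comp fst))) (pf_pers.comp snd)
  · exact PF.disj prim_states (pf_q.comp snd)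
  · exact PF.conj prim_states ((pf_q.comp snd).imp pf_body)

theorem prim_counter : Primrec CMOp.counter := by
  have : Primrec (fun op : CMOp => (Sum.casesOn op (fun i => i)
    (fun op' => Sum.casesOn op' (fun i => i) (fun i => i)) : ℕ)) := by
    refine sumCasesOn Primrec.id snd.to₂ ?_
    exact (sumCasesOn (f := fun x : CMOp × (ℕ ⊕ ℕ) => x.2)
      (g := fun _ i => i) (h := fun _ i => i) snd snd.to₂ snd.to₂)
  exact this.of_eq (fun op => by rcases op with i | i | i <;> rfl)

theorem prim_wf : PrimrecPred CMWF := by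
  have hS : Primrec (fun M : CMDesc => M.2.1) := fst.comp snd
  have hT : Primrec (fun M : CMDesc => M.2.2.1) := fst.comp (snd.comp snd)
  have hI : Primrec (fun M : CMDesc => M.2.2.2) := snd.comp (snd.comp snd)
  have h1 : PrimrecPred (fun M : CMDesc => 1 < M.1) := nat_lt.comp (const 1) fst
  have h2 : PrimrecPred (fun M : CMDesc => ∀ q ∈ M.2.2.1, q < M.2.1) :=
    pp_forall hT (nat_lt.comp snd (hS.comp fst))
  have h3 : PrimrecPred (fun M : CMDesc => ∀ t ∈ M.2.2.2, t.1 < M.2.1 ∧ t.1 ∉ M.2.2.1 ∧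
      t.2.2 < M.2.1 ∧ CMOp.counter t.2.1 < M.1) := by
    refine pp_forall hI (PrimrecPred.and ?_ (PrimrecPred.and (PrimrecPred.not ?_)
      (PrimrecPred.and ?_ ?_)))
    · exact nat_lt.comp (fst.comp snd) (hS.comp fst)
    · exact pp_mem (hT.comp fst) (fst.comp snd)
    · exact nat_lt.comp (snd.comp (snd.comp snd)) (hS.comp fst)
    · exact nat_lt.comp (prim_counter.comp (fst.comp (snd.comp snd))) (fst.comp fst)
  have h4 : PrimrecPred (fun M : CMDesc => ∀ q ∈ List.range M.2.1, q ∈ M.2.2.1 ∨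
      ∃ t ∈ M.2.2.2, t.1 = q) := by
    refine pp_forall (list_range.comp hS) (PrimrecPred.or ?_ ?_)
    · exact pp_mem (hT.comp fst) snd
    · exact pp_exists (hI.comp fst) (Primrec.eq.comp (fst.comp snd) (snd.comp fst))
  refine (h1.and (h2.and (h3.and h4))).of_eq (fun M => ?_)
  unfold CMWF
  simp only [List.mem_range, or_iff_not_imp_left]
end forms

open Classical in
theorem lcm_reduces : ManyOneReducible LCMOmegaReach (BCodes (ExpDiffSat IsOmegaFrame)) := by
  refine ⟨fun p => if CMWF p.1 then encodeB (mainF p) else Nat.pair 5 0, ?_, ?_⟩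
  · exact (Primrec.ite (prim_wf.comp Primrec.fst) pf_main.prim (Primrec.const _)).to_comp
  · intro p
    beta_reduce
    split_ifs with h
    · constructor
      · exact fun hp => ⟨_, rfl, completeness hp⟩
      · rintro ⟨φ, h1, h2⟩
        rw [encodeB_inj h1] at h2
        exact soundness h h2
    · constructor
      · exact fun hp => absurd hp.1 h
      · rintro ⟨φ, h1, -⟩
        exact absurd h1 (encodeB_ne φ)
end partA5

section partC1
/-! ## Counter programs -/

inductive Prog : Type
  | inc : ℕ → Prog
  | dec : ℕ → Prog
  | seq : Prog → Prog → Prog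
  | loop : ℕ → Prog → Prog

inductive Exec : Prog → (ℕ → ℕ) → (ℕ → ℕ) → Prop
  | inc (i s) : Exec (.inc i) s (Function.update s i (s i + 1))
  | dec (i s) : Exec (.dec i) s (Function.update s i (s i - 1))
  | seq {P Q s s' s''} : Exec P s s' → Exec Q s' s'' → Exec (.seq P Q) s s''
  | loop0 {i P s} : s i = 0 → Exec (.loop i P) s s
  | loopS {i P s s' s''} : s i ≠ 0 → Exec P (Function.update s i (s i - 1)) s' →
      Exec (.loop i P) s' s'' → Exec (.loop i P) s s''

theorem Exec.cast {P : Prog} {s s' t t' : ℕ → ℕ} (h : Exec P s t) (h1 : s = s') (h2 : t = t') :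
    Exec P s' t' := h1 ▸ h2 ▸ h

theorem exec_iter {i : ℕ} {P : Prog} (F : ℕ → ℕ → ℕ) (N : ℕ) (hF : ∀ k ≤ N, F k i = N - k)
    (hP : ∀ k < N, Exec P (Function.update (F k) i (N - k - 1)) (F (k+1))) :
    Exec (.loop i P) (F 0) (F N) := by
  suffices ∀ d k, k + d = N → Exec (.loop i P) (F k) (F N) from this N 0 (by omega)
  intro d
  induction d with
  | zero =>
    intro k hk
    obtain rfl : k = N := by omega
    exact Exec.loop0 (by rw [hF k le_rfl]; omega)
  | succ d ih =>
    intro k hk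
    have h := hF k (by omega)
    refine Exec.loopS (by omega) ?_ (ih (k+1) (by omega))
    rw [h]
    exact hP k (by omega)

theorem exec_clear {r z : ℕ} {s : ℕ → ℕ} (hz : s z = 0) (hrz : z ≠ r) :
    Exec (.loop r (.dec z)) s (Function.update s r 0) := by
  refine (exec_iter (fun k => Function.update s r (s r - k)) (s r) (by simp) ?_).cast (by simp)
    (by simp)
  intro k hk
  refine (Exec.dec z _).cast rfl ?_
  funext x
  simp only [Function.update_apply]
  split_ifs <;> simp_all <;> omega

theorem exec_move {r t : ℕ} {s : ℕ → ℕ} (h : r ≠ t) :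
    Exec (.loop r (.inc t)) s (Function.update (Function.update s r 0) t (s t + s r)) := by
  refine (exec_iter (fun k => Function.update (Function.update s r (s r - k)) t (s t + k)) (s r)
    (by simp [Function.update_apply, h]) ?_).cast (by simp) (by simp)
  intro k hk
  refine (Exec.inc t _).cast rfl ?_
  funext x
  simp only [Function.update_apply]
  split_ifs <;> simp_all <;> omega

def copyP (r t z : ℕ) : Prog := .seq (.loop r (.seq (.inc t) (.inc z))) (.loop z (.inc r))

theorem exec_copy {r t z : ℕ} {s : ℕ → ℕ} (h1 : r ≠ t) (h2 : r ≠ z) (h3 : t ≠ z) (hz : s z = 0) :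
    Exec (copyP r t z) s (Function.update s t (s t + s r)) := by
  refine Exec.seq (exec_iter (fun k => Function.update (Function.update (Function.update s r
    (s r - k)) t (s t + k)) z k) (s r) (by simp [Function.update_apply, h1, h2]) ?_ |>.cast ?_ rfl)
    ((exec_move h2.symm).cast rfl ?_)
  · intro k hk
    refine Exec.seq (Exec.inc _ _) ((Exec.inc _ _).cast rfl ?_)
    funext x
    simp only [Function.update_apply]
    split_ifs <;> simp_all <;> omega
  · funext x
    simp only [Function.update_apply]
    split_ifs <;> simp_all
  · funext x
    simp only [Function.update_apply]
    split_ifs <;> simp_all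

def Comp {n : ℕ} (f : List.Vector ℕ n → ℕ) : Prop :=
  ∀ (ins : Fin n → ℕ) (out w : ℕ), (∀ i, ins i < w) → out < w → (∀ i, ins i ≠ out) →
    ∃ P, ∀ s : ℕ → ℕ, (∀ i, w ≤ i → s i = 0) → s out = 0 → ∀ v : List.Vector ℕ n,
      (∀ i, v.get i = s (ins i)) → Exec P s (Function.update s out (f v))

theorem comp_clear (w : ℕ) : ∀ n z, w + n ≤ z → ∃ P, ∀ s : ℕ → ℕ, s z = 0 →
    Exec P s (fun r => if w ≤ r ∧ r < w + n then 0 else s r) := by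
  intro n
  induction n with
  | zero =>
    intro z hz
    refine ⟨.loop z (.inc z), fun s hs => (Exec.loop0 hs).cast rfl ?_⟩
    funext x
    rw [if_neg (by omega)]
  | succ n ih =>
    intro z hz
    obtain ⟨P, hP⟩ := ih z (by omega)
    refine ⟨.seq P (.loop (w+n) (.dec z)), fun s hs => Exec.seq (hP s hs)
      ((exec_clear ?_ (by omega)).cast rfl ?_)⟩
    · simp only [hs, ite_self]
    · funext x
      simp only [Function.update_apply]
      split_ifs <;> first | rfl | omega

theorem comp_stage {m n : ℕ} (g : ℕ → List.Vector ℕ m → ℕ) (hg : ∀ i < n, Comp (g i))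
    (ins : Fin m → ℕ) (w : ℕ) (hi : ∀ i, ins i < w) : ∀ j ≤ n, ∃ P, ∀ s : ℕ → ℕ,
      (∀ i, w ≤ i → s i = 0) → ∀ v : List.Vector ℕ m, (∀ i, v.get i = s (ins i)) →
      Exec P s (fun r => if w ≤ r ∧ r < w + j then g (r - w) v else s r) := by
  intro j
  induction j with
  | zero =>
    intro _
    refine ⟨.loop w (.inc w), fun s hs v _ => (Exec.loop0 (hs w le_rfl)).cast rfl ?_⟩
    funext x
    rw [if_neg (by omega)]
  | succ j ih =>
    intro hj
    obtain ⟨P, hP⟩ := ih (by omega)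
    obtain ⟨Q, hQ⟩ := hg j (by omega) ins (w+j) (w+n) (fun i => by have := hi i; omega) (by omega)
      (fun i => by have := hi i; omega)
    refine ⟨.seq P Q, fun s hs v hv => Exec.seq (hP s hs v hv) ((hQ _ ?_ ?_ v ?_).cast rfl ?_)⟩
    · intro i hi'
      rw [if_neg (by omega), hs i (by omega)]
    · rw [if_neg (by omega), hs _ (by omega)]
    · intro i
      have := hi i
      rw [if_neg (by omega), hv]
    · funext x
      simp only [Function.update_apply]
      by_cases h : x = w + j
      · subst h
        rw [if_pos rfl, if_pos (by omega)]
        congr 1; omega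
      · rw [if_neg h]
        split_ifs <;> first | rfl | omega

theorem comp_all {n : ℕ} {f : List.Vector ℕ n → ℕ} (hf : Nat.Primrec' f) : Comp f := by
  induction hf with
  | zero =>
    intro ins out w h1 h2 h3
    refine ⟨.loop w (.inc w), fun s hs ho v _ => (Exec.loop0 (hs w le_rfl)).cast rfl ?_⟩
    funext x
    simp only [Function.update_apply]
    split_ifs <;> simp_all
  | succ =>
    intro ins out w h1 h2 h3
    refine ⟨.seq (copyP (ins 0) out w) (.inc out), fun s hs ho v hv =>
      Exec.seq (exec_copy (h3 0) (h1 0).ne h2.ne (hs w le_rfl)) ((Exec.inc _ _).cast rfl ?_)⟩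
    have : v.head = s (ins 0) := by rw [← hv 0, List.Vector.get_zero]
    funext x
    simp only [Function.update_apply]
    split_ifs <;> simp_all
  | get i =>
    intro ins out w h1 h2 h3
    refine ⟨copyP (ins i) out w, fun s hs ho v hv =>
      (exec_copy (h3 i) (h1 i).ne h2.ne (hs w le_rfl)).cast rfl ?_⟩
    beta_reduce
    rw [hv, ho, zero_add]
  | @comp m n f g hf hg ihf ihg =>
    intro ins out w h1 h2 h3
    set g' : ℕ → List.Vector ℕ m → ℕ := fun k v => if h : k < n then g ⟨k, h⟩ v else 0 with hg'
    obtain ⟨P, hP⟩ := comp_stage (n := n) g' (fun i hi => by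
      have : g' i = g ⟨i, hi⟩ := by funext v; simp [hg', hi]
      rw [this]; exact ihg _) ins w h1 n le_rfl
    obtain ⟨Q, hQ⟩ := ihf (fun i => w + i) out (w + n) (fun i => by have := i.2; omega) (by omega)
      (fun i => by omega)
    obtain ⟨R, hR⟩ := comp_clear w n (w+n) le_rfl
    refine ⟨.seq P (.seq Q R), fun s hs ho v hv => Exec.seq (hP s hs v hv) (Exec.seq
      (hQ _ ?_ ?_ (List.Vector.ofFn fun i => g i v) ?_) ((hR _ ?_).cast rfl ?_))⟩
    · intro i hi'
      rw [if_neg (by omega), hs i (by omega)]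
    · rw [if_neg (by omega), ho]
    · intro i
      have := i.2
      simp only [List.Vector.get_ofFn]
      rw [if_pos (by omega)]
      simp [hg']
    · simp only [Function.update_apply]
      rw [if_neg (by omega), if_neg (by omega), hs _ (by omega)]
    · funext x
      simp only [Function.update_apply]
      split_ifs with h4 h5 h6
      · omega
      · rw [hs x (by omega)]
      · rfl
      · rfl
  | @prec n f g hf hg ihf ihg =>
    intro ins out w h1 h2 h3
    obtain ⟨P, hP⟩ := ihf (fun i => ins i.succ) (w+1) (w+4) (fun i => by have := h1 i.succ; omega)
      (by omega) (fun i => by have := h1 i.succ; omega)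
    obtain ⟨Q, hQ⟩ := ihg (Fin.cons w (Fin.cons (w+1) (fun i => ins i.succ))) (w+2) (w+4)
      (by
        refine Fin.cases (by simp) (Fin.cases (by simp) (fun i => ?_))
        have := h1 i.succ
        simp only [Fin.cons_succ]; omega)
      (by omega)
      (by
        refine Fin.cases (by simp) (Fin.cases (by simp) (fun i => ?_))
        have := h1 i.succ
        simp only [Fin.cons_succ]; omega)
    refine ⟨.seq P (.seq (copyP (ins 0) (w+3) (w+4)) (.seq
      (.loop (w+3) (.seq Q (.seq (.loop (w+1) (.dec (w+4)))
        (.seq (.loop (w+2) (.inc (w+1))) (.inc w)))))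
      (.seq (.loop w (.dec (w+4))) (.loop (w+1) (.inc out))))), fun s hs ho v hv => ?_⟩
    have hv0 : v.head = s (ins 0) := by rw [← hv 0, List.Vector.get_zero]
    have hvt : ∀ i, v.tail.get i = s (ins i.succ) := by
      intro i; rw [← hv i.succ, List.Vector.get_tail_succ]
    set G : ℕ → ℕ := fun k => Nat.rec (f v.tail) (fun y IH => g (y ::ᵥ IH ::ᵥ v.tail)) k with hG
    have hGs : ∀ k, G (k+1) = g (k ::ᵥ G k ::ᵥ v.tail) := fun k => rfl
    have h10 := h1 0
    have s0 := hs w le_rfl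
    have s1 := hs (w+1) (by omega)
    have s2 := hs (w+2) (by omega)
    have s3 := hs (w+3) (by omega)
    have s4 := hs (w+4) (by omega)
    refine Exec.seq (hP s (fun i hi => hs i (by omega)) s1 v.tail hvt)
      (Exec.seq (exec_copy (by omega) (by omega) (by omega) ?_) (Exec.seq
      ((exec_iter (fun k => Function.update (Function.update (Function.update s w k) (w+1) (G k))
        (w+3) (s (ins 0) - k)) (s (ins 0)) ?_ ?_).cast ?_ rfl)
      (Exec.seq (exec_clear ?_ (by omega)) ((exec_move (by omega)).cast rfl ?_))))
    · simp only [Function.update_apply]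
      rw [if_neg (by omega), s4]
    · intro k _; simp
    · intro k hk
      refine Exec.seq (hQ _ ?_ ?_ (k ::ᵥ G k ::ᵥ v.tail) ?_) (Exec.seq (exec_clear ?_ (by omega))
        (Exec.seq (exec_move (by omega)) ((Exec.inc _ _).cast rfl ?_)))
      · intro i hi
        simp only [Function.update_apply]
        rw [if_neg (by omega), if_neg (by omega), if_neg (by omega), if_neg (by omega),
          hs i (by omega)]
      · simp [Function.update_apply, s2]
      · refine Fin.cases ?_ (Fin.cases ?_ (fun i => ?_))
        · simp
        · rw [List.Vector.get_cons_succ, List.Vector.get_zero]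
          simp
        · have := h1 i.succ
          simp only [List.Vector.get_cons_succ, hvt, Fin.cons_succ, Function.update_apply]
          rw [if_neg (by omega), if_neg (by omega), if_neg (by omega), if_neg (by omega)]
      · simp [Function.update_apply, s4]
      · rw [hGs]
        funext x
        simp only [Function.update_apply]
        split_ifs <;> first | omega | simp_all <;> omega
    · funext x
      simp only [Function.update_apply]
      rw [if_neg (show ins 0 ≠ w+1 by omega)]
      by_cases e3 : x = w+3
      · subst e3; simp [s3]
      by_cases e1 : x = w+1
      · subst e1; simp [hG]
      by_cases e0 : x = w
      · subst e0; simp [s0]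
      simp [e0, e1, e3]
    · simp [Function.update_apply, s4]
    · beta_reduce
      rw [hv0]
      change _ = Function.update s out (G (s (ins 0)))
      funext x
      simp only [Function.update_apply]
      have : out ≠ w+3 := by omega
      have : out ≠ w+1 := by omega
      have : out ≠ w := by omega
      by_cases eo : x = out
      · subst eo; simp [*]
      by_cases e3 : x = w+3
      · subst e3; simp [s3, eo]
      by_cases e1 : x = w+1
      · subst e1; simp [s1, eo]
      by_cases e0 : x = w
      · subst e0; simp [s0, eo]
      simp [e0, e1, e3, eo]
end partC1

section partC2
open Relation

/-! ## Compiling programs into reliable counter machines -/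

abbrev Instr : Type := ℕ × CMOp × ℕ

def IStep (I : List Instr) (σ σ' : CMConfig) : Prop := CMStep (0, 0, [], I) σ σ'

theorem IStep.mono {I J : List Instr} (h : I ⊆ J) {σ σ' : CMConfig} (hs : IStep I σ σ') :
    IStep J σ σ' := by
  obtain ⟨op, q', h1, h2, h3⟩ := hs
  exact ⟨op, q', h h1, h2, h3⟩

theorem IStep.inc {I : List Instr} {q i q' : ℕ} (h : (q, Sum.inl i, q') ∈ I) (s : ℕ → ℕ) :
    IStep I (q, s) (q', Function.update s i (s i + 1)) :=
  ⟨_, _, h, rfl, by simp, fun j hj => by simp [hj]⟩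
theorem IStep.dec {I : List Instr} {q i q' : ℕ} (h : (q, Sum.inr (Sum.inl i), q') ∈ I) (s : ℕ → ℕ)
    (hs : s i ≠ 0) : IStep I (q, s) (q', Function.update s i (s i - 1)) :=
  ⟨_, _, h, rfl, Nat.pos_of_ne_zero hs, by simp; omega, fun j hj => by simp [hj]⟩
theorem IStep.zt {I : List Instr} {q i q' : ℕ} (h : (q, Sum.inr (Sum.inr i), q') ∈ I) (s : ℕ → ℕ)
    (hs : s i = 0) : IStep I (q, s) (q', s) :=
  ⟨_, _, h, rfl, hs, fun _ => rfl⟩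

def opI (i : ℕ) : CMOp := Sum.inl i
def opD (i : ℕ) : CMOp := Sum.inr (Sum.inl i)
def opZ (i : ℕ) : CMOp := Sum.inr (Sum.inr i)

def psize : Prog → ℕ
  | .inc _ => 1
  | .dec _ => 1
  | .seq P Q => psize P + psize Q
  | .loop _ P => 1 + psize P

def pcomp : Prog → ℕ → ℕ → List Instr
  | .inc i, b, e => [(b, opI i, e)]
  | .dec i, b, e => [(b, opD i, e), (b, opZ i, e)]
  | .seq P Q, b, e => pcomp P b (b + psize P) ++ pcomp Q (b + psize P) e
  | .loop i P, b, e => [(b, opZ i, e), (b, opD i, b + 1)] ++ pcomp P (b + 1) b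

def pmax : Prog → ℕ
  | .inc i => i
  | .dec i => i
  | .seq P Q => max (pmax P) (pmax Q)
  | .loop i P => max i (pmax P)

theorem pcomp_src (P : Prog) : ∀ b e, ∀ t ∈ pcomp P b e, b ≤ t.1 ∧ t.1 < b + psize P := by
  induction P with
  | inc i => intro b e t ht; simp [pcomp] at ht; subst ht; simp [psize]
  | dec i => intro b e t ht; simp [pcomp] at ht; rcases ht with rfl | rfl <;> simp [psize]
  | seq P Q ih1 ih2 =>
    intro b e t ht
    simp only [pcomp, List.mem_append] at ht
    simp only [psize]
    rcases ht with ht | ht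
    · have := ih1 _ _ t ht; omega
    · have := ih2 _ _ t ht; omega
  | loop i P ih =>
    intro b e t ht
    simp only [pcomp, List.mem_append, List.mem_cons, List.not_mem_nil, or_false] at ht
    simp only [psize]
    rcases ht with (rfl | rfl) | ht
    · simp
    · simp
    · have := ih _ _ t ht; omega

theorem pcomp_max (P : Prog) : ∀ b e, ∀ t ∈ pcomp P b e, CMOp.counter t.2.1 ≤ pmax P := by
  induction P with
  | inc i => intro b e t ht; simp [pcomp] at ht; subst ht; exact le_rfl
  | dec i => intro b e t ht; simp [pcomp] at ht; rcases ht with rfl | rfl <;> exact le_rfl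
  | seq P Q ih1 ih2 =>
    intro b e t ht
    simp only [pcomp, List.mem_append] at ht
    simp only [pmax]
    rcases ht with ht | ht
    · have := ih1 _ _ t ht; omega
    · have := ih2 _ _ t ht; omega
  | loop i P ih =>
    intro b e t ht
    simp only [pcomp, List.mem_append, List.mem_cons, List.not_mem_nil, or_false] at ht
    simp only [pmax]
    rcases ht with (rfl | rfl) | ht
    · exact le_max_left _ _
    · exact le_max_left _ _
    · have := ih _ _ t ht; omega

def Compat (t t' : Instr) : Prop :=
  t.1 = t'.1 → t = t' ∨ ∃ i, (t.2.1 = opD i ∧ t'.2.1 = opZ i) ∨ (t.2.1 = opZ i ∧ t'.2.1 = opD i)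

def Det (I : List Instr) : Prop := ∀ t ∈ I, ∀ t' ∈ I, Compat t t'

theorem Det.append {I J : List Instr} (h1 : Det I) (h2 : Det J)
    (h : ∀ t ∈ I, ∀ t' ∈ J, t.1 ≠ t'.1) : Det (I ++ J) := by
  intro t ht t' ht' e
  rw [List.mem_append] at ht ht'
  rcases ht with ht | ht <;> rcases ht' with ht' | ht'
  · exact h1 t ht t' ht' e
  · exact absurd e (h t ht t' ht')
  · exact absurd e.symm (h t' ht' t ht)
  · exact h2 t ht t' ht' e

theorem det_pair (b i e e' : ℕ) : Det [(b, opZ i, e), (b, opD i, e')] := by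
  intro t ht t' ht' _
  simp only [List.mem_cons, List.not_mem_nil, or_false] at ht ht'
  rcases ht with rfl | rfl <;> rcases ht' with rfl | rfl
  · left; rfl
  · right; exact ⟨i, Or.inr ⟨rfl, rfl⟩⟩
  · right; exact ⟨i, Or.inl ⟨rfl, rfl⟩⟩
  · left; rfl

theorem det_pair' (b i e e' : ℕ) : Det [(b, opD i, e), (b, opZ i, e')] := by
  intro t ht t' ht' _
  simp only [List.mem_cons, List.not_mem_nil, or_false] at ht ht'
  rcases ht with rfl | rfl <;> rcases ht' with rfl | rfl
  · left; rfl
  · right; exact ⟨i, Or.inl ⟨rfl, rfl⟩⟩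
  · right; exact ⟨i, Or.inr ⟨rfl, rfl⟩⟩
  · left; rfl

theorem pcomp_det (P : Prog) : ∀ b e, Det (pcomp P b e) := by
  induction P with
  | inc i =>
    intro b e t ht t' ht' _
    simp [pcomp] at ht ht'
    left; rw [ht, ht']
  | dec i => intro b e; exact det_pair' _ _ _ _
  | seq P Q ih1 ih2 =>
    intro b e
    refine (ih1 _ _).append (ih2 _ _) (fun t ht t' ht' => ?_)
    have := pcomp_src _ _ _ t ht
    have := pcomp_src _ _ _ t' ht'
    omega
  | loop i P ih =>
    intro b e
    refine (det_pair _ _ _ _).append (ih _ _) (fun t ht t' ht' => ?_)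
    have := pcomp_src _ _ _ t' ht'
    simp only [List.mem_cons, List.not_mem_nil, or_false] at ht
    rcases ht with rfl | rfl <;> simp only <;> omega

theorem Det.step {I : List Instr} (h : Det I) {σ σ1 σ2 : CMConfig} (h1 : IStep I σ σ1)
    (h2 : IStep I σ σ2) : σ1 = σ2 := by
  obtain ⟨op, q', m1, e1, r1⟩ := h1
  obtain ⟨op', q'', m2, e2, r2⟩ := h2
  rcases h _ m1 _ m2 rfl with e | ⟨i, ⟨e, e'⟩ | ⟨e, e'⟩⟩
  · simp only [Prod.mk.injEq, true_and] at e
    obtain ⟨rfl, rfl⟩ := e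
    refine Prod.ext (e1.trans e2.symm) (funext fun j => ?_)
    rcases op with i | i | i
    · by_cases hj : j = i
      · subst hj; rw [r1.1, r2.1]
      · rw [r1.2 j hj, r2.2 j hj]
    · by_cases hj : j = i
      · subst hj
        have := r1.2.1
        have := r2.2.1
        omega
      · rw [r1.2.2 j hj, r2.2.2 j hj]
    · rw [r1.2 j, r2.2 j]
  · simp only at e e'
    subst e; subst e'
    have := r1.1
    have := r2.1
    omega
  · simp only at e e'
    subst e; subst e'
    have := r1.1
    have := r2.1
    omega

theorem pcomp_exec {P : Prog} {s s' : ℕ → ℕ} (h : Exec P s s') : ∀ (I : List Instr) (b e : ℕ),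
    pcomp P b e ⊆ I → ReflTransGen (IStep I) (b, s) (e, s') := by
  induction h with
  | inc i s => intro I b e h; exact .single (IStep.inc (h (by simp [pcomp, opI])) s)
  | dec i s =>
    intro I b e h
    by_cases hs : s i = 0
    · have : Function.update s i (s i - 1) = s := by
        funext x; simp only [Function.update_apply]; split_ifs with hx
        · subst hx; omega
        · rfl
      rw [this]
      exact .single (IStep.zt (h (by simp [pcomp, opZ])) s hs)
    · exact .single (IStep.dec (h (by simp [pcomp, opD])) s hs)
  | seq _ _ ih1 ih2 =>
    intro I b e h
    exact (ih1 I b _ (fun x hx => h (List.mem_append_left _ hx))).trans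
      (ih2 I _ e (fun x hx => h (List.mem_append_right _ hx)))
  | loop0 hs => intro I b e h; exact .single (IStep.zt (h (by simp [pcomp, opZ])) _ hs)
  | loopS hs _ _ ih1 ih2 =>
    intro I b e h
    refine .head (IStep.dec (q' := b+1) (h (by simp [pcomp, opD])) _ hs) ?_
    exact (ih1 I (b+1) b (fun x hx => h (List.mem_append_right _ hx))).trans (ih2 I b e h)

/-- Exact length runs. -/
def RunN (I : List Instr) : ℕ → CMConfig → CMConfig → Prop
  | 0, σ, σ' => σ = σ'
  | n+1, σ, σ' => ∃ τ, RunN I n σ τ ∧ IStep I τ σ'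

theorem Det.bound {I : List Instr} (h : Det I) {σ σ' : CMConfig}
    (hr : ReflTransGen (IStep I) σ σ') (hend : ∀ τ, ¬ IStep I σ' τ) :
    ∃ s, ∀ τ, ¬ RunN I (s+1) σ τ := by
  have : ∃ s, RunN I s σ σ' := by
    induction hr with
    | refl => exact ⟨0, rfl⟩
    | tail _ hs ih =>
      clear hend
      rename_i b c hab
      have : ∃ s, RunN I s σ b := by
        clear ih hs
        induction hab with
        | refl => exact ⟨0, rfl⟩
        | tail _ hs ih => obtain ⟨s, ih⟩ := ih; exact ⟨s+1, _, ih, hs⟩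
      obtain ⟨s, hs'⟩ := this
      exact ⟨s+1, _, hs', hs⟩
  obtain ⟨s, hs⟩ := this
  refine ⟨s, fun τ ⟨τ', h1, h2⟩ => hend τ ?_⟩
  have : ∀ n a b, RunN I n σ a → RunN I n σ b → a = b := by
    intro n
    induction n with
    | zero => intro a b h1 h2; exact h1.symm.trans h2
    | succ n ih =>
      rintro a b ⟨a', h1, h1'⟩ ⟨b', h2, h2'⟩
      obtain rfl := ih _ _ h1 h2
      exact h.step h1' h2'
  rwa [this _ _ _ hs h1]

theorem reliable_machine (χ : ℕ → ℕ → ℕ) (hχ : Primrec₂ χ) (hχ01 : ∀ n k, χ n k ≤ 1) :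
    ∃ (K : ℕ) (I : ℕ → List Instr) (st : ℕ → ℕ), 1 < K ∧ Primrec I ∧ Primrec st ∧
      (∀ n, ∀ t ∈ I n, CMOp.counter t.2.1 < K) ∧
      (∀ n, (∃ k, χ n (k+1) = 0) → ∃ s, ∀ τ, ¬ RunN (I n) (s+1) (st n, fun _ => 0) τ) ∧
      (∀ n, (∀ k, χ n k = 1) → ∀ T, ∃ σ, ReflTransGen (IStep (I n)) (st n, fun _ => 0) σ ∧
        T ≤ σ.2 1) := by
  obtain ⟨P, hP⟩ := comp_all (Nat.Primrec'.prim_iff₂.2 hχ) ![0, 1] 2 3 (by decide) (by decide)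
    (by decide)
  have hP : ∀ n k, Exec P (fun i => if i = 0 then n else if i = 1 then k else 0)
      (fun i => if i = 0 then n else if i = 1 then k else if i = 2 then χ n k else 0) := by
    intro n k
    refine (hP _ ?_ ?_ (n ::ᵥ k ::ᵥ List.Vector.nil) ?_).cast rfl ?_
    · intro i hi; show (if i = 0 then n else if i = 1 then k else 0) = 0
      rw [if_neg (by omega), if_neg (by omega)]
    · simp
    · intro i; fin_cases i
      · rfl
      · rfl
    · funext i
      simp only [Function.update_apply]
      split_ifs <;> first | rfl | omega | simp_all
  let cfg : ℕ → ℕ → ℕ → ℕ → ℕ := fun n k f i =>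
    if i = 0 then n else if i = 1 then k else if i = 2 then f else 0
  let W : Prog := .seq (.inc 1) P
  have hW : ∀ n k f, Exec W (Function.update (cfg n k f) 2 0) (cfg n (k+1) (χ n (k+1))) := by
    intro n k f
    refine Exec.seq (Exec.inc _ _) ((hP n (k+1)).cast ?_ rfl)
    funext i
    simp only [Function.update_apply, cfg]
    split_ifs <;> first | rfl | omega | simp_all
  let L : Prog := .loop 2 W
  let e : ℕ := psize L
  let st : ℕ → ℕ := fun n => e + 1 + n
  let I : ℕ → List Instr := fun n => pcomp L 0 e ++ ((e+1, opI 2, 0) ::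
    (List.range n).map (fun i => (e+1+(i+1), opI 0, e+1+i)))
  have hdet : ∀ n, Det (I n) := by
    intro n
    refine (pcomp_det _ _ _).append ?_ ?_
    · intro t ht t' ht' he
      left
      simp only [List.mem_cons, List.mem_map, List.mem_range] at ht ht'
      rcases ht with rfl | ⟨i, hi, rfl⟩ <;> rcases ht' with rfl | ⟨i', hi', rfl⟩
      · rfl
      · simp only at he; omega
      · simp only at he; omega
      · simp only at he
        obtain rfl : i = i' := by omega
        rfl
    · intro t ht t' ht'
      have := pcomp_src _ _ _ t ht
      simp only [List.mem_cons, List.mem_map, List.mem_range] at ht'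
      have he : 0 + psize L = e := by simp [e]
      rcases ht' with rfl | ⟨i, hi, rfl⟩ <;> simp only <;> omega
  have hpre : ∀ n, ReflTransGen (IStep (I n)) (st n, fun _ => 0) (0, cfg n 0 1) := by
    intro n
    have h1 : ∀ j ≤ n, ReflTransGen (IStep (I n)) (st n, fun _ => 0)
        (e + 1 + (n - j), cfg j 0 0) := by
      intro j
      induction j with
      | zero =>
        intro _
        have : cfg 0 0 0 = fun _ => 0 := by funext i; simp [cfg]
        rw [this]; exact .refl
      | succ j ih =>
        intro hj
        refine (ih (by omega)).tail ?_
        have hm : (e + 1 + (n - j), Sum.inl 0, e + 1 + (n - (j+1))) ∈ I n := by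
          refine List.mem_append_right _ (List.mem_cons_of_mem _ (List.mem_map.2
            ⟨n - (j+1), List.mem_range.2 (by omega), ?_⟩))
          have : n - (j+1) + 1 = n - j := by omega
          rw [this]; rfl
        have := IStep.inc hm (cfg j 0 0)
        have hc : Function.update (cfg j 0 0) 0 (cfg j 0 0 0 + 1) = cfg (j+1) 0 0 := by
          funext i
          simp only [Function.update_apply, cfg]
          split_ifs <;> first | rfl | omega | simp_all
        rwa [hc] at this
    refine (h1 n le_rfl).tail ?_
    have hm : (e + 1 + (n - n), Sum.inl 2, 0) ∈ I n := by
      refine List.mem_append_right _ ?_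
      simp [opI]
    have := IStep.inc hm (cfg n 0 0)
    have hc : Function.update (cfg n 0 0) 2 (cfg n 0 0 2 + 1) = cfg n 0 1 := by
      funext i
      simp only [Function.update_apply, cfg]
      split_ifs <;> first | rfl | omega | simp_all
    rwa [hc] at this
  have hsub : ∀ n, pcomp L 0 e ⊆ I n := fun n x hx => List.mem_append_left _ hx
  refine ⟨pmax L + 3, I, st, by omega, ?_, ?_, ?_, ?_, ?_⟩
  · open Primrec in
    refine list_append.comp (const _) (list_cons.comp (const _) (list_map list_range ?_))
    have hq : ∀ a : ℕ, Primrec (fun x : ℕ × ℕ => a + x.2) := fun a => nat_add.comp (const a) snd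
    exact pair (nat_add.comp (const _) (succ.comp snd)) (pair (const _) (hq _))
  · exact Primrec.nat_add.comp (Primrec.const _) Primrec.id
  · intro n t ht
    rcases List.mem_append.1 ht with ht | ht
    · have := pcomp_max _ _ _ t ht
      omega
    · simp only [List.mem_cons, List.mem_map, List.mem_range] at ht
      rcases ht with rfl | ⟨i, hi, rfl⟩
      · simp [opI, CMOp.counter]
      · simp [opI, CMOp.counter]
  · rintro n ⟨k, hk⟩
    have hf1 : ∀ k, Function.update (cfg n k 1) 2 0 = Function.update (cfg n k 1) 2
        (cfg n k 1 2 - 1) := by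
      intro k; simp [cfg]
    have hex : ∀ d k, χ n (k+d+1) = 0 → ∃ s', Exec L (cfg n k 1) s' := by
      intro d
      induction d with
      | zero =>
        intro k hk
        exact ⟨_, Exec.loopS (by simp [cfg]) ((hW n k 1).cast (hf1 k) rfl)
              (Exec.loop0 (by simpa [cfg] using hk))⟩
      | succ d ih =>
        intro k hk
        by_cases h0 : χ n (k+1) = 0
        · exact ⟨_, Exec.loopS (by simp [cfg]) ((hW n k 1).cast (hf1 k) rfl)
              (Exec.loop0 (by simpa [cfg] using h0))⟩
        · have h1 : χ n (k+1) = 1 := by have := hχ01 n (k+1); omega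
          obtain ⟨s', hs'⟩ := ih (k+1) (by rw [← hk]; congr 1; omega)
          refine ⟨s', Exec.loopS (by simp [cfg]) ((hW n k 1).cast (hf1 k) rfl) ?_⟩
          rw [h1]; exact hs'
    obtain ⟨s', hs'⟩ := hex k 0 (by simpa using hk)
    refine (hdet n).bound ((hpre n).trans (pcomp_exec hs' (I n) 0 e (hsub n))) ?_
    rintro τ ⟨op, q', hm, -⟩
    rcases List.mem_append.1 hm with ht | ht
    · have := pcomp_src _ _ _ _ ht
      simp [e] at this
    · simp only [List.mem_cons, List.mem_map, List.mem_range, Prod.mk.injEq] at ht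
      rcases ht with ⟨h, -⟩ | ⟨i, hi, h, -⟩ <;> omega
  · intro n hn T
    have : ∀ T, ReflTransGen (IStep (I n)) (st n, fun _ => 0) (0, cfg n T 1) := by
      intro T
      induction T with
      | zero => exact hpre n
      | succ T ih =>
        refine ih.trans (.head (IStep.dec (q' := 1) (i := 2) (hsub n (by simp [L, pcomp, opD])) _
          (by simp [cfg])) ?_)
        have := pcomp_exec (hW n T 1) (I n) 1 0 (fun x hx => hsub n (List.mem_append_right _ hx))
        rw [hn] at this
        exact this
    exact ⟨_, this T, by simp [cfg]⟩
end partC2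

section partD1
open Relation

/-! ## The lossy machine: budget counter, simulation, resets -/

def OpRel : CMOp → (ℕ → ℕ) → (ℕ → ℕ) → Prop
  | Sum.inl i, c, c' => c' = Function.update c i (c i + 1)
  | Sum.inr (Sum.inl i), c, c' => c i ≠ 0 ∧ c' = Function.update c i (c i - 1)
  | Sum.inr (Sum.inr i), c, c' => c i = 0 ∧ c' = c

theorem istep_iff {I : List Instr} {σ σ' : CMConfig} :
    IStep I σ σ' ↔ ∃ op, (σ.1, op, σ'.1) ∈ I ∧ OpRel op σ.2 σ'.2 := by
  constructor
  · rintro ⟨op, q', h1, rfl, h3⟩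
    refine ⟨op, h1, ?_⟩
    rcases op with i | i | i
    · funext j
      by_cases hj : j = i
      · subst hj; rw [h3.1]; simp
      · rw [h3.2 j hj]; simp [hj]
    · refine ⟨Nat.pos_iff_ne_zero.1 h3.1, ?_⟩
      funext j
      by_cases hj : j = i
      · subst hj
        have := h3.2.1
        simp; omega
      · rw [h3.2.2 j hj]; simp [hj]
    · exact ⟨h3.1, funext h3.2⟩
  · rintro ⟨op, h1, h2⟩
    obtain ⟨q, c⟩ := σ
    obtain ⟨q', c'⟩ := σ'
    rcases op with i | i | i
    · cases h2; exact IStep.inc h1 _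
    · obtain ⟨h2, h3⟩ := h2
      cases h3; exact IStep.dec h1 _ h2
    · obtain ⟨h2, h3⟩ := h2
      cases h3; exact IStep.zt h1 _ h2

def Qs (q : ℕ) : ℕ := Nat.pair 0 q
def Rs (j : ℕ) : ℕ := Nat.pair 1 j
def Mid (l a : ℕ) : ℕ := Nat.pair 2 (Nat.pair l a)
def Vs : ℕ := Nat.pair 3 0

@[simp] theorem Qs_inj {a b : ℕ} : Qs a = Qs b ↔ a = b := by simp [Qs, Nat.pair_eq_pair]
@[simp] theorem Rs_inj {a b : ℕ} : Rs a = Rs b ↔ a = b := by simp [Rs, Nat.pair_eq_pair]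
@[simp] theorem Mid_inj {l a l' a' : ℕ} : Mid l a = Mid l' a' ↔ l = l' ∧ a = a' := by
  simp [Mid, Nat.pair_eq_pair]
@[simp] theorem Qs_Rs {a b : ℕ} : Qs a ≠ Rs b := by simp [Qs, Rs, Nat.pair_eq_pair]
@[simp] theorem Rs_Qs {a b : ℕ} : Rs a ≠ Qs b := by simp [Qs, Rs, Nat.pair_eq_pair]
@[simp] theorem Qs_Mid {a b l : ℕ} : Qs a ≠ Mid l b := by simp [Qs, Mid, Nat.pair_eq_pair]
@[simp] theorem Mid_Qs {a b l : ℕ} : Mid l b ≠ Qs a := by simp [Qs, Mid, Nat.pair_eq_pair]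
@[simp] theorem Rs_Mid {a b l : ℕ} : Rs a ≠ Mid l b := by simp [Rs, Mid, Nat.pair_eq_pair]
@[simp] theorem Mid_Rs {a b l : ℕ} : Mid l b ≠ Rs a := by simp [Rs, Mid, Nat.pair_eq_pair]
@[simp] theorem Qs_Vs {a : ℕ} : Qs a ≠ Vs := by simp [Qs, Vs, Nat.pair_eq_pair]
@[simp] theorem Vs_Qs {a : ℕ} : Vs ≠ Qs a := by simp [Qs, Vs, Nat.pair_eq_pair]
@[simp] theorem Rs_Vs {a : ℕ} : Rs a ≠ Vs := by simp [Rs, Vs, Nat.pair_eq_pair]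
@[simp] theorem Vs_Rs {a : ℕ} : Vs ≠ Rs a := by simp [Rs, Vs, Nat.pair_eq_pair]
@[simp] theorem Mid_Vs {l a : ℕ} : Mid l a ≠ Vs := by simp [Mid, Vs, Nat.pair_eq_pair]
@[simp] theorem Vs_Mid {l a : ℕ} : Vs ≠ Mid l a := by simp [Mid, Vs, Nat.pair_eq_pair]

/-- move a token from counter `l` to counter `l'` while going from `a` to `b` -/
def mv (a l l' b : ℕ) : List Instr := [(a, opD l, Mid l' b), (Mid l' b, opI l', b)]

def trI (t : Instr) : List Instr :=
  (Qs t.1, opZ 0, Rs 1) :: Sum.elim (fun j => mv (Qs t.1) 0 (j+1) (Qs t.2.2))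
    (Sum.elim (fun j => mv (Qs t.1) (j+1) 0 (Qs t.2.2))
      (fun j => [(Qs t.1, opZ (j+1), Qs t.2.2)])) t.2.1

def resI (K : ℕ) : List Instr :=
  (List.range K).flatMap (fun j => (Rs (j+1), opZ (j+1), Rs (j+2)) ::
    mv (Rs (j+1)) (j+1) 0 (Rs (j+1)))

def JI (K st : ℕ) (I : List Instr) : List Instr :=
  (Rs (K+1), opI 0, Qs st) :: (Rs (K+1), opD 0, Vs) :: (Vs, opD 0, Vs) ::
    (resI K ++ I.flatMap trI)

theorem sum_upd {N l : ℕ} (h : l < N) (c : ℕ → ℕ) (x : ℕ) :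
    ∑ i ∈ Finset.range N, Function.update c l x i + c l = ∑ i ∈ Finset.range N, c i + x := by
  have h1 := Finset.sum_update_of_mem (Finset.mem_range.2 h) c x
  have h2 := Finset.add_sum_erase (Finset.range N) c (Finset.mem_range.2 h)
  rw [h1, Finset.sdiff_singleton_eq_erase]; omega

theorem sum_mv {N l l' : ℕ} (h : l < N) (h' : l' < N) (c : ℕ → ℕ) (hc : c l ≠ 0) :
    ∑ i ∈ Finset.range N, Function.update (Function.update c l (c l - 1)) l'
      (Function.update c l (c l - 1) l' + 1) i = ∑ i ∈ Finset.range N, c i := by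
  have h1 := sum_upd h c (c l - 1)
  have h2 := sum_upd h' (Function.update c l (c l - 1)) (Function.update c l (c l - 1) l' + 1)
  omega

section inv
variable (K st s : ℕ) (I : List Instr)

def BInv (a : ℕ) (c : ℕ → ℕ) : Prop :=
  (∃ q, a = Qs q ∧ (∑ i ∈ Finset.range (K+1), c i ≤ s ∨
    (∑ i ∈ Finset.range (K+1), c i ≤ s + 1 ∧
      ∃ i d, RunN I i (st, fun _ => 0) (q, d) ∧ ∀ j < K, d j = c (j+1)))) ∨
  (∃ j, a = Rs j ∧ ∑ i ∈ Finset.range (K+1), c i ≤ s ∧ ∀ i, 1 ≤ i → i < j → i ≤ K → c i = 0) ∨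
  (a = Vs ∧ ∑ i ∈ Finset.range (K+1), c i ≤ s)

def LInv (a : ℕ) (c : ℕ → ℕ) : Prop :=
  BInv K st s I a c ∨ ∃ l b, a = Mid l b ∧ BInv K st s I b (Function.update c l (c l + 1))

variable {K st s I}

theorem BInv.mono {a : ℕ} {c c' : ℕ → ℕ} (h : BInv K st s I a c) (hc : ∀ i, c' i ≤ c i) :
    BInv K st s I a c' := by
  have hs : ∑ i ∈ Finset.range (K+1), c' i ≤ ∑ i ∈ Finset.range (K+1), c i :=
    Finset.sum_le_sum (fun i _ => hc i)
  rcases h with ⟨q, rfl, h | ⟨h, i, d, hr, hd⟩⟩ | ⟨j, rfl, h, h'⟩ | ⟨rfl, h⟩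
  · exact Or.inl ⟨q, rfl, Or.inl (hs.trans h)⟩
  · refine Or.inl ⟨q, rfl, ?_⟩
    by_cases he : ∀ j < K, d j = c' (j+1)
    · exact Or.inr ⟨hs.trans h, i, d, hr, he⟩
    · left
      push Not at he
      obtain ⟨j, hj, he⟩ := he
      have : ∑ i ∈ Finset.range (K+1), c' i < ∑ i ∈ Finset.range (K+1), c i := by
        refine Finset.sum_lt_sum (fun i _ => hc i) ⟨j+1, Finset.mem_range.2 (by omega), ?_⟩
        have := hc (j+1)
        have := hd j hj
        omega
      omega
  · exact Or.inr (Or.inl ⟨j, rfl, hs.trans h, fun i h1 h2 h3 => by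
      have := h' i h1 h2 h3
      have := hc i
      omega⟩)
  · exact Or.inr (Or.inr ⟨rfl, hs.trans h⟩)

theorem LInv.mono {a : ℕ} {c c' : ℕ → ℕ} (h : LInv K st s I a c) (hc : ∀ i, c' i ≤ c i) :
    LInv K st s I a c' := by
  rcases h with h | ⟨l, b, rfl, h⟩
  · exact Or.inl (h.mono hc)
  · refine Or.inr ⟨l, b, rfl, h.mono (fun i => ?_)⟩
    simp only [Function.update_apply]
    split_ifs
    · have := hc l; omega
    · exact hc i

theorem not_BInv_Mid {l a : ℕ} {c : ℕ → ℕ} : ¬ BInv K st s I (Mid l a) c := by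
  simp [BInv]

theorem LInv.base {a : ℕ} {c : ℕ → ℕ} (h : LInv K st s I a c) (ha : ∀ l b, a ≠ Mid l b) :
    BInv K st s I a c := by
  rcases h with h | ⟨l, b, e, -⟩
  · exact h
  · exact absurd e (ha l b)

theorem BInv.Q {q : ℕ} {c : ℕ → ℕ} (h : BInv K st s I (Qs q) c) :
    (∑ i ∈ Finset.range (K+1), c i ≤ s ∨
    (∑ i ∈ Finset.range (K+1), c i ≤ s + 1 ∧
      ∃ i d, RunN I i (st, fun _ => 0) (q, d) ∧ ∀ j < K, d j = c (j+1))) := by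
  simpa [BInv] using h
theorem BInv.R {j : ℕ} {c : ℕ → ℕ} (h : BInv K st s I (Rs j) c) :
    ∑ i ∈ Finset.range (K+1), c i ≤ s ∧ ∀ i, 1 ≤ i → i < j → i ≤ K → c i = 0 := by
  simpa [BInv] using h
theorem BInv.V {c : ℕ → ℕ} (h : BInv K st s I Vs c) :
    ∑ i ∈ Finset.range (K+1), c i ≤ s := by
  simpa [BInv] using h

def Pres (K st s : ℕ) (I : List Instr) (t : Instr) : Prop :=
  ∀ c c', LInv K st s I t.1 c → OpRel t.2.1 c c' → LInv K st s I t.2.2 c'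

theorem pres_mv {a l l' b : ℕ} (ha : ∀ l b, a ≠ Mid l b)
    (h : ∀ c, BInv K st s I a c → c l ≠ 0 → BInv K st s I b (Function.update
      (Function.update c l (c l - 1)) l' (Function.update c l (c l - 1) l' + 1))) :
    ∀ t ∈ mv a l l' b, Pres K st s I t := by
  intro t ht c c' hc hop
  simp only [mv, List.mem_cons, List.not_mem_nil, or_false] at ht
  rcases ht with rfl | rfl
  · obtain ⟨h1, rfl⟩ := hop
    exact Or.inr ⟨l', b, rfl, h c (hc.base ha) h1⟩
  · obtain rfl := hop
    rcases hc with hc | ⟨l1, b1, e, hc⟩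
    · exact absurd hc not_BInv_Mid
    · simp only [Mid_inj] at e
      obtain ⟨rfl, rfl⟩ := e
      exact Or.inl hc

theorem RunN.prefix {m n : ℕ} {σ τ : CMConfig} (h : RunN I (m + n) σ τ) : ∃ τ', RunN I m σ τ' := by
  induction n generalizing τ with
  | zero => exact ⟨τ, h⟩
  | succ n ih => obtain ⟨τ', h1, _⟩ := h; exact ih h1

theorem RunN.sum_le {n : ℕ} {q : ℕ} {τ : CMConfig} (h : RunN I n (q, fun _ => 0) τ) :
    ∑ j ∈ Finset.range K, τ.2 j ≤ n := by
  induction n generalizing τ with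
  | zero => cases h; simp
  | succ n ih =>
    obtain ⟨σ, h1, h2⟩ := h
    have := ih h1
    obtain ⟨op, -, h3⟩ := istep_iff.1 h2
    rcases op with i | i | i
    · rw [show τ.2 = _ from h3]
      by_cases hi : i < K
      · have := sum_upd hi σ.2 (σ.2 i + 1); omega
      · have : ∑ j ∈ Finset.range K, Function.update σ.2 i (σ.2 i + 1) j
            = ∑ j ∈ Finset.range K, σ.2 j := by
          refine Finset.sum_congr rfl (fun j hj => ?_)
          rw [Function.update_of_ne]
          rintro rfl
          exact hi (Finset.mem_range.1 hj)
        omega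
    · have : ∑ j ∈ Finset.range K, τ.2 j ≤ ∑ j ∈ Finset.range K, σ.2 j := by
        refine Finset.sum_le_sum (fun j _ => ?_)
        rw [h3.2, Function.update_apply]
        split_ifs with hj
        · subst hj; omega
        · exact le_rfl
      omega
    · rw [h3.2]; omega

theorem pres_JI (hs : ∀ τ, ¬ RunN I (s+1) (st, fun _ => 0) τ)
    (hI : ∀ t ∈ I, CMOp.counter t.2.1 < K) : ∀ t ∈ JI K st I, Pres K st s I t := by
  intro t ht
  simp only [JI, resI, List.mem_cons, List.mem_append, List.mem_flatMap, List.mem_range] at ht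
  rcases ht with rfl | rfl | rfl | ⟨j, hj, rfl | ht⟩ | ⟨⟨q, op, q'⟩, hu, ht⟩
  · intro c c' hc hop
    obtain ⟨h1, h2⟩ := (hc.base (by simp)).R
    obtain rfl := hop
    refine Or.inl (Or.inl ⟨st, rfl, Or.inr ⟨?_, 0, fun _ => 0, rfl, ?_⟩⟩)
    · have := sum_upd (N := K+1) (l := 0) (by omega) c (c 0 + 1); omega
    · intro j hj; simp [h2 (j+1) (by omega) (by omega) (by omega)]
  · intro c c' hc hop
    obtain ⟨h1, h2⟩ := (hc.base (by simp)).R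
    obtain ⟨h3, rfl⟩ := hop
    refine Or.inl (Or.inr (Or.inr ⟨rfl, ?_⟩))
    have := sum_upd (N := K+1) (l := 0) (by omega) c (c 0 - 1); omega
  · intro c c' hc hop
    have h1 := (hc.base (by simp)).V
    obtain ⟨h3, rfl⟩ := hop
    refine Or.inl (Or.inr (Or.inr ⟨rfl, ?_⟩))
    have := sum_upd (N := K+1) (l := 0) (by omega) c (c 0 - 1); omega
  · intro c c' hc hop
    obtain ⟨h1, h2⟩ := (hc.base (by simp)).R
    obtain ⟨h3, rfl⟩ := hop
    refine Or.inl (Or.inr (Or.inl ⟨j+2, rfl, h1, fun i h4 h5 h6 => ?_⟩))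
    by_cases hi : i = j + 1
    · rw [hi]; exact h3
    · exact h2 i h4 (by omega) h6
  · refine pres_mv (by simp) ?_ t ht
    intro c hc h0
    obtain ⟨h1, h2⟩ := hc.R
    refine Or.inr (Or.inl ⟨j+1, rfl, ?_, fun i h4 h5 h6 => ?_⟩)
    · rw [sum_mv (by omega) (by omega) c h0]; exact h1
    · rw [Function.update_of_ne (by omega), Function.update_of_ne (by omega)]
      exact h2 i h4 h5 h6
  · simp only [trI, List.mem_cons] at ht
    have hcnt := hI _ hu
    rcases ht with rfl | ht
    · intro c c' hc hop
      have h1 := (hc.base (by simp)).Q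
      obtain ⟨h3, rfl⟩ := hop
      refine Or.inl (Or.inr (Or.inl ⟨1, rfl, ?_, fun i h4 h5 h6 => by omega⟩))
      rcases h1 with h1 | ⟨h1, i, d, hr, hd⟩
      · exact h1
      · have hi : i ≤ s := by
          by_contra hi
          obtain ⟨m, rfl⟩ := Nat.exists_eq_add_of_le (show s + 1 ≤ i by omega)
          obtain ⟨τ, hτ⟩ := hr.prefix
          exact hs τ hτ
        have := hr.sum_le (K := K)
        rw [Finset.sum_range_succ', h3]
        rw [Finset.sum_congr rfl (fun j hj => (hd j (Finset.mem_range.1 hj)).symm)]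
        rw [Nat.add_zero]
        exact le_trans this hi
    · rcases op with j | j | j
      · replace hcnt : j < K := hcnt
        refine pres_mv (by simp) ?_ t ht
        intro c hc h0
        refine Or.inl ⟨q', rfl, ?_⟩
        rw [sum_mv (by omega) (by omega) c h0]
        rcases hc.Q with h1 | ⟨h1, i, d, hr, hd⟩
        · exact Or.inl h1
        · refine Or.inr ⟨h1, i+1, _, ⟨_, hr, IStep.inc hu d⟩, fun j' hj' => ?_⟩
          by_cases he : j' = j
          · subst he; simp [hd j' hj']
          · rw [Function.update_of_ne he, Function.update_of_ne (by omega),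
              Function.update_of_ne (by omega), hd j' hj']
      · replace hcnt : j < K := hcnt
        refine pres_mv (by simp) ?_ t ht
        intro c hc h0
        refine Or.inl ⟨q', rfl, ?_⟩
        rw [sum_mv (by omega) (by omega) c h0]
        rcases hc.Q with h1 | ⟨h1, i, d, hr, hd⟩
        · exact Or.inl h1
        · refine Or.inr ⟨h1, i+1, _, ⟨_, hr, IStep.dec hu d (by rw [hd j hcnt]; exact h0)⟩,
            fun j' hj' => ?_⟩
          by_cases he : j' = j
          · subst he; simp [hd j' hj']
          · rw [Function.update_of_ne he, Function.update_of_ne (by omega),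
              Function.update_of_ne (by omega), hd j' hj']
      · replace hcnt : j < K := hcnt
        simp only [Sum.elim_inr, List.mem_cons, List.not_mem_nil, or_false] at ht
        subst ht
        intro c c' hc hop
        obtain ⟨h3, rfl⟩ := hop
        refine Or.inl (Or.inl ⟨q', rfl, ?_⟩)
        rcases (hc.base (by simp)).Q with h1 | ⟨h1, i, d, hr, hd⟩
        · exact Or.inl h1
        · exact Or.inr ⟨h1, i+1, _, ⟨_, hr, IStep.zt hu d (by rw [hd j hcnt]; exact h3)⟩, hd⟩

theorem JI_V {a b : ℕ} {op : CMOp} (h : (a, op, b) ∈ JI K st I) :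
    (a = Vs → b = Vs) ∧ (b = Vs → op = opD 0) := by
  simp only [JI, resI, List.mem_cons, List.mem_append, List.mem_flatMap, List.mem_range] at h
  rcases h with e | e | e | ⟨j, hj, e | ht⟩ | ⟨⟨q, op, q'⟩, hu, ht⟩
  · simp_all
  · simp_all
  · simp_all
  · simp_all
  · simp only [mv, List.mem_cons, List.not_mem_nil, or_false] at ht
    rcases ht with e | e <;> simp_all
  · simp only [trI, mv, List.mem_cons] at ht
    rcases ht with e | ht
    · simp_all
    · rcases op with j | j | j <;>
        simp only [Sum.elim_inl, Sum.elim_inr, List.mem_cons, List.not_mem_nil, or_false] at ht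
      · rcases ht with e | e <;> simp_all
      · rcases ht with e | e <;> simp_all
      · simp_all

theorem visits_bound (hs : ∀ τ, ¬ RunN I (s+1) (st, fun _ => 0) τ)
    (hI : ∀ t ∈ I, CMOp.counter t.2.1 < K) {M : CMDesc} (hM : M.2.2.2 = JI K st I)
    {B : ℕ} {ρ : ℕ → CMConfig} (h0 : ρ 0 = zeroConfig (Rs (K+1)))
    (hρ : ∀ n < B, CMStepLossy M (ρ n) (ρ (n+1))) :
    ((Finset.range (B+1)).filter (fun n => (ρ n).1 = Vs)).card ≤ s + 1 := by
  suffices H : ∀ m ≤ B, LInv K st s I (ρ m).1 (ρ m).2 ∧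
      ((ρ m).1 ≠ Vs → ((Finset.range (m+1)).filter (fun n => (ρ n).1 = Vs)).card = 0) ∧
      ((ρ m).1 = Vs → ((Finset.range (m+1)).filter (fun n => (ρ n).1 = Vs)).card + (ρ m).2 0
        ≤ s + 1) by
    obtain ⟨-, h1, h2⟩ := H B le_rfl
    by_cases h : (ρ B).1 = Vs
    · have := h2 h; omega
    · have := h1 h; omega
  intro m
  induction m with
  | zero =>
    intro _
    rw [h0]
    refine ⟨Or.inl (Or.inr (Or.inl ⟨K+1, rfl, by simp [zeroConfig], fun _ _ _ _ => rfl⟩)), ?_, ?_⟩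
    · intro _
      simp [Finset.filter_singleton, h0, zeroConfig]
    · simp [zeroConfig]
  | succ m ih =>
    intro hm
    obtain ⟨h1, h2, h3⟩ := ih (by omega)
    obtain ⟨c1, c2, hst, hc1, hc2⟩ := hρ m (by omega)
    have hst : IStep (JI K st I) ((ρ m).1, c1) ((ρ (m+1)).1, c2) := by rw [← hM]; exact hst
    obtain ⟨op, hmem, hop⟩ := istep_iff.1 hst
    simp only at hmem hop
    have hinv := pres_JI hs hI _ hmem c1 c2 (h1.mono hc1) hop
    have hV := JI_V hmem
    rw [Finset.range_add_one, Finset.filter_insert]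
    refine ⟨hinv.mono hc2, fun hne => ?_, fun he => ?_⟩
    · rw [if_neg hne]
      exact h2 (fun e => hne (hV.1 e))
    · rw [if_pos he, Finset.card_insert_of_notMem (by simp)]
      rw [hV.2 he] at hop
      obtain ⟨hp, hc⟩ := hop
      have e1 := hc2 0
      have e2 := hc1 0
      rw [hc, Function.update_self] at e1
      by_cases hv : (ρ m).1 = Vs
      · have := h3 hv; omega
      · have h4 := h2 hv
        have h5 := ((he ▸ hinv).base (by simp)).V
        have h6 : c2 0 ≤ ∑ i ∈ Finset.range (K+1), c2 i :=
          Finset.single_le_sum (f := c2) (fun _ _ => Nat.zero_le _) (Finset.mem_range.2 (by omega))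
        have := hc2 0
        omega
end inv
end partD1

section partD2
open Relation

section sim
variable {K st : ℕ} {I : List Instr}

abbrev LR (K st : ℕ) (I : List Instr) : CMConfig → CMConfig → Prop :=
  ReflTransGen (IStep (JI K st I))

theorem lr_mv {a l l' b : ℕ} (h : mv a l l' b ⊆ JI K st I) (c : ℕ → ℕ) (hc : c l ≠ 0) :
    LR K st I (a, c) (b, Function.update (Function.update c l (c l - 1)) l'
      (Function.update c l (c l - 1) l' + 1)) :=
  (ReflTransGen.single (IStep.dec (q' := Mid l' b) (h (by simp [mv, opD])) c hc)).tail
    (IStep.inc (h (by simp [mv, opI])) _)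

def tok (K T : ℕ) (d : ℕ → ℕ) : ℕ → ℕ
  | 0 => T - ∑ j ∈ Finset.range K, d j
  | i+1 => d i

theorem tok_sum {T : ℕ} {d : ℕ → ℕ} (h : ∑ j ∈ Finset.range K, d j ≤ T) :
    ∑ i ∈ Finset.range (K+1), tok K T d i = T := by
  rw [Finset.sum_range_succ']
  simp only [tok]; omega

def Done (K st : ℕ) (I : List Instr) (T : ℕ) : Prop :=
  ∃ c, LR K st I (Qs st, tok K T (fun _ => 0)) (Rs 1, c) ∧ ∑ i ∈ Finset.range (K+1), c i = T

theorem trI_sub {t : Instr} (h : t ∈ I) : trI t ⊆ JI K st I := by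
  intro x hx
  simp only [JI, List.mem_cons, List.mem_append, List.mem_flatMap]
  exact Or.inr (Or.inr (Or.inr (Or.inr ⟨t, h, hx⟩)))

theorem simulate (hI : ∀ t ∈ I, CMOp.counter t.2.1 < K) (T : ℕ) {σ : CMConfig}
    (h : ReflTransGen (IStep I) (st, fun _ => 0) σ) :
    Done K st I T ∨ (∑ j ∈ Finset.range K, σ.2 j ≤ T ∧
      LR K st I (Qs st, tok K T (fun _ => 0)) (Qs σ.1, tok K T σ.2)) := by
  induction h with
  | refl => right; exact ⟨by simp, .refl⟩
  | tail _ hs ih =>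
    rename_i σ σ' _
    rcases ih with ih | ⟨hT, ih⟩
    · exact Or.inl ih
    by_cases hd : ∑ j ∈ Finset.range K, σ.2 j = T
    · left
      obtain ⟨op, hm, -⟩ := istep_iff.1 hs
      refine ⟨tok K T σ.2, ih.tail ?_, tok_sum hT⟩
      refine IStep.zt (i := 0) (trI_sub hm (by simp [trI, opZ])) _ ?_
      simp [tok, hd]
    right
    obtain ⟨q, d⟩ := σ
    obtain ⟨q', d'⟩ := σ'
    obtain ⟨op, hm, hop⟩ := istep_iff.1 hs
    simp only at hm hop hT hd ih ⊢
    have hcnt := hI _ hm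
    have hsub := trI_sub (K := K) (st := st) hm
    rcases op with j | j | j
    · replace hcnt : j < K := hcnt
      obtain rfl := hop
      have hsum := sum_upd hcnt d (d j + 1)
      refine ⟨by omega, ih.trans ?_⟩
      have := lr_mv (a := Qs q) (l := 0) (l' := j+1) (b := Qs q')
        (fun x hx => hsub (List.mem_cons_of_mem _ hx)) (tok K T d) (by simp only [tok]; omega)
      convert this using 2
      funext i
      cases i with
      | zero => simp only [tok, ne_eq, Nat.zero_ne_add_one, not_false_eq_true,
                  Function.update_of_ne, Function.update_self]; omega
      | succ i => simp [tok, Function.update_apply]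
    · replace hcnt : j < K := hcnt
      obtain ⟨h0, rfl⟩ := hop
      have hsum := sum_upd hcnt d (d j - 1)
      refine ⟨by omega, ih.trans ?_⟩
      have := lr_mv (a := Qs q) (l := j+1) (l' := 0) (b := Qs q')
        (fun x hx => hsub (List.mem_cons_of_mem _ hx)) (tok K T d) (by simpa only [tok] using h0)
      convert this using 2
      funext i
      cases i with
      | zero => simp only [tok, ne_eq, Nat.zero_ne_add_one, not_false_eq_true,
                  Function.update_of_ne, Function.update_self]; omega
      | succ i => simp [tok, Function.update_apply]
    · obtain ⟨h0, rfl⟩ := hop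
      refine ⟨hT, ih.tail (IStep.zt (i := j+1) (hsub (List.mem_cons_of_mem _ ?_)) _ h0)⟩
      simp [opZ]

theorem drain1 {j : ℕ} (hj : j < K) (T : ℕ) : ∀ (m : ℕ) (c : ℕ → ℕ), c (j+1) = m →
    (∀ i, 1 ≤ i → i < j+1 → c i = 0) → ∑ i ∈ Finset.range (K+1), c i = T →
    ∃ c', LR K st I (Rs (j+1), c) (Rs (j+2), c') ∧ (∀ i, 1 ≤ i → i < j+2 → c' i = 0) ∧
      ∑ i ∈ Finset.range (K+1), c' i = T := by
  have hmem : ((Rs (j+1), opZ (j+1), Rs (j+2)) :: mv (Rs (j+1)) (j+1) 0 (Rs (j+1)))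
      ⊆ JI K st I := by
    intro x hx
    simp only [JI, resI, List.mem_cons, List.mem_append, List.mem_flatMap, List.mem_range]
    exact Or.inr (Or.inr (Or.inr (Or.inl ⟨j, hj, List.mem_cons.1 hx⟩)))
  intro m
  induction m with
  | zero =>
    intro c h1 h2 h3
    refine ⟨c, .single (IStep.zt (i := j+1) (hmem (List.mem_cons_self ..)) c h1), ?_, h3⟩
    intro i hi hi'
    by_cases he : i = j+1
    · rw [he, h1]
    · exact h2 i hi (by omega)
  | succ m ih =>
    intro c h1 h2 h3
    have h4 := lr_mv (a := Rs (j+1)) (l := j+1) (l' := 0) (b := Rs (j+1)) (K := K) (st := st)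
      (I := I) (fun x hx => hmem (List.mem_cons_of_mem _ hx)) c (by omega)
    obtain ⟨c', h5, h6, h7⟩ := ih (Function.update
      (Function.update c (j+1) (c (j+1) - 1)) 0 (Function.update c (j+1) (c (j+1) - 1) 0 + 1))
      (by simp [h1]) (fun i hi hi' => by
      rw [Function.update_of_ne (by omega), Function.update_of_ne (by omega)]
      exact h2 i hi hi') ((sum_mv (by omega) (by omega) c (by omega)).trans h3)
    exact ⟨c', h4.trans h5, h6, h7⟩

theorem drain {T : ℕ} {c : ℕ → ℕ} (hc : ∑ i ∈ Finset.range (K+1), c i = T) :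
    ∃ c', LR K st I (Rs 1, c) (Rs (K+1), c') ∧ c' 0 = T := by
  have : ∀ j ≤ K, ∃ c', LR K st I (Rs 1, c) (Rs (j+1), c') ∧ (∀ i, 1 ≤ i → i < j+1 → c' i = 0) ∧
      ∑ i ∈ Finset.range (K+1), c' i = T := by
    intro j
    induction j with
    | zero => intro _; exact ⟨c, .refl, fun i h1 h2 => by omega, hc⟩
    | succ j ih =>
      intro hj
      obtain ⟨c1, h1, h2, h3⟩ := ih (by omega)
      obtain ⟨c2, h4, h5, h6⟩ := drain1 (st := st) (I := I) (show j < K by omega) T _ c1 rfl h2 h3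
      exact ⟨c2, h1.trans h4, h5, h6⟩
  obtain ⟨c', h1, h2, h3⟩ := this K le_rfl
  refine ⟨c', h1, ?_⟩
  rw [Finset.sum_range_succ', Finset.sum_eq_zero (fun i hi => h2 (i+1) (by omega)
    (by have := Finset.mem_range.1 hi; omega))] at h3
  simpa using h3

theorem visits_unbounded {M : CMDesc} (hM : M.2.2.2 = JI K st I) (hK : 1 < K)
    (hI : ∀ t ∈ I, CMOp.counter t.2.1 < K)
    (hinf : ∀ T, ∃ σ, ReflTransGen (IStep I) (st, fun _ => 0) σ ∧ T ≤ σ.2 1) (T : ℕ) :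
    ∃ σ v, LRun M (Rs (K+1)) Vs σ v ∧ T ≤ v := by
  have hlossy : ∀ {σ σ' : CMConfig}, IStep (JI K st I) σ σ' → CMStepLossy M σ σ' := by
    intro σ σ' h
    rw [← hM] at h
    exact ⟨σ.2, σ'.2, h, fun _ => le_rfl, fun _ => le_rfl⟩
  have hLR : ∀ {σ σ' : CMConfig}, LR K st I σ σ' → ∀ v, LRun M (Rs (K+1)) Vs σ v →
      ∃ v', LRun M (Rs (K+1)) Vs σ' v' := by
    intro σ σ' h v hv
    induction h with
    | refl => exact ⟨v, hv⟩
    | tail _ hs ih => obtain ⟨v', ih⟩ := ih; exact ⟨_, ih.step (hlossy hs)⟩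
  have hdone : ∀ T, Done K st I T := by
    intro T
    obtain ⟨σ, h1, h2⟩ := hinf (T+1)
    rcases simulate hI T h1 with h | ⟨h, -⟩
    · exact h
    · have : σ.2 1 ≤ ∑ j ∈ Finset.range K, σ.2 j :=
        Finset.single_le_sum (f := σ.2) (fun _ _ => Nat.zero_le _) (Finset.mem_range.2 hK)
      omega
  have hgrow : ∀ T, ∃ c v, LRun M (Rs (K+1)) Vs (Rs (K+1), c) v ∧ c 0 = T := by
    intro T
    induction T with
    | zero => exact ⟨_, _, LRun.start, rfl⟩
    | succ T ih =>
      obtain ⟨c, v, h1, h2⟩ := ih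
      have hst : CMStepLossy M (Rs (K+1), c) (Qs st, tok K (T+1) (fun _ => 0)) := by
        have := IStep.inc (I := JI K st I) (q := Rs (K+1)) (i := 0) (q' := Qs st)
          (List.mem_cons_self ..) c
        rw [← hM] at this
        refine ⟨_, _, this, fun _ => le_rfl, fun i => ?_⟩
        cases i with
        | zero => simp [tok, h2]
        | succ i => simp [tok]
      obtain ⟨c1, h3, h4⟩ := hdone (T+1)
      obtain ⟨c2, h5, h6⟩ := drain (st := st) (I := I) h4
      obtain ⟨v', hv'⟩ := hLR (h3.trans h5) _ (h1.step hst)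
      exact ⟨c2, v', hv', h6⟩
  have hfin : ∀ m, ∃ c v, LRun M (Rs (K+1)) Vs (Vs, c) v ∧ m ≤ v ∧ m + c 0 = T + 1 ∨ T + 1 < m
      ∨ m = 0 := by
    intro m
    induction m with
    | zero => exact ⟨fun _ => 0, 0, Or.inr (Or.inr rfl)⟩
    | succ m ih =>
      by_cases hm : T + 1 < m + 1
      · exact ⟨fun _ => 0, 0, Or.inr (Or.inl hm)⟩
      obtain ⟨c, v, h | h | h⟩ := ih
      · have hs := IStep.dec (I := JI K st I) (q := Vs) (i := 0) (q' := Vs)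
          (by simp [JI, opD]) c (by omega)
        have := h.1.step (hlossy hs)
        refine ⟨_, _, Or.inl ⟨this, ?_, ?_⟩⟩
        · simp; omega
        · simp; omega
      · omega
      · subst h
        obtain ⟨c, v, h1, h2⟩ := hgrow (T+1)
        have hs := IStep.dec (I := JI K st I) (q := Rs (K+1)) (i := 0) (q' := Vs)
          (by simp [JI, opD]) c (by omega)
        have := h1.step (hlossy hs)
        refine ⟨_, _, Or.inl ⟨this, ?_, ?_⟩⟩
        · simp
        · simp [h2]; omega
  obtain ⟨c, v, h | h | h⟩ := hfin (T+1)
  · exact ⟨_, _, h.1, by omega⟩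
  · omega
  · omega
end sim
end partD2

section partD3
open Relation

/-! ## Undecidability of lossy omega-reachability -/

def stBound (L : List Instr) : ℕ := L.foldr (fun t n => t.1 + t.2.2 + 1 + n) 0

theorem stBound_lt {L : List Instr} {t : Instr} (h : t ∈ L) :
    t.1 < stBound L ∧ t.2.2 < stBound L := by
  induction L with
  | nil => cases h
  | cons u L ih =>
    have e : stBound (u :: L) = u.1 + u.2.2 + 1 + stBound L := rfl
    rcases List.mem_cons.1 h with rfl | h
    · omega
    · have := ih h; omega

def mkM (N : ℕ) (L : List Instr) : CMDesc :=
  (N, stBound L, (List.range (stBound L)).filterMap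
    (fun q => if ∀ t ∈ L, t.1 ≠ q then some q else none), L)

theorem mkM_mem {N : ℕ} {L : List Instr} {q : ℕ} :
    q ∈ (mkM N L).2.2.1 ↔ q < stBound L ∧ ∀ t ∈ L, t.1 ≠ q := by
  simp only [mkM, List.mem_filterMap, List.mem_range, Option.ite_none_right_eq_some,
    Option.some.injEq]
  constructor
  · rintro ⟨a, h1, h2, rfl⟩; exact ⟨h1, h2⟩
  · rintro ⟨h1, h2⟩; exact ⟨q, h1, h2, rfl⟩

theorem mkM_wf {N : ℕ} {L : List Instr} (hN : 1 < N) (hL : ∀ t ∈ L, CMOp.counter t.2.1 < N) :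
    CMWF (mkM N L) := by
  refine ⟨hN, fun q hq => (mkM_mem.1 hq).1, fun t ht => ⟨(stBound_lt ht).1, fun h =>
    (mkM_mem.1 h).2 t ht rfl, (stBound_lt ht).2, hL t ht⟩, fun q hq hq' => ?_⟩
  by_contra hne
  push Not at hne
  exact hq' (mkM_mem.2 ⟨hq, hne⟩)

theorem stBound_prim : Primrec stBound := by
  have := Primrec.list_foldr (σ := ℕ) (f := fun L : List Instr => L) (g := fun _ => 0)
    (h := fun _ (x : Instr × ℕ) => x.1.1 + x.1.2.2 + 1 + x.2) Primrec.id (Primrec.const 0)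
    (by
      open Primrec in
      have h1 : Primrec (fun p : List Instr × (Instr × ℕ) => p.2.1) := fst.comp snd
      have h2 : Primrec (fun p : List Instr × (Instr × ℕ) => p.2.1.1 + p.2.1.2.2 + 1) :=
        succ.comp (nat_add.comp (fst.comp h1) (snd.comp (snd.comp h1)))
      exact nat_add.comp h2 (snd.comp snd))
  exact this

theorem mkM_prim (N : ℕ) : Primrec (mkM N) := by
  open Primrec in
  refine pair (const N) (pair stBound_prim (pair ?_ Primrec.id))
  refine listFilterMap (list_range.comp stBound_prim) ?_
  refine Primrec.ite (c := fun x : List Instr × ℕ => ∀ t ∈ x.1, t.1 ≠ x.2) ?_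
    (option_some.comp snd) (const none)
  exact pp_forall (R := fun (x : List Instr × ℕ) t => t.1 ≠ x.2) fst
    (PrimrecPred.not (Primrec.eq.comp (fst.comp snd) (snd.comp fst)))

theorem Qs_prim : Primrec Qs := Primrec₂.natPair.comp (Primrec.const 0) Primrec.id
theorem Mid_prim {α : Type} [Primcodable α] {f g : α → ℕ} (hf : Primrec f) (hg : Primrec g) :
    Primrec (fun a => Mid (f a) (g a)) :=
  Primrec₂.natPair.comp (Primrec.const 2) (Primrec₂.natPair.comp hf hg)
theorem opI_prim : Primrec opI := Primrec.sumInl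
theorem opD_prim : Primrec opD := Primrec.sumInr.comp Primrec.sumInl
theorem opZ_prim : Primrec opZ := Primrec.sumInr.comp Primrec.sumInr
theorem mv_prim {α : Type} [Primcodable α] {a l l' b : α → ℕ} (ha : Primrec a) (hl : Primrec l)
    (hl' : Primrec l') (hb : Primrec b) : Primrec (fun x => mv (a x) (l x) (l' x) (b x)) := by
  open Primrec in
  exact list_cons.comp (pair ha (pair (opD_prim.comp hl) (Mid_prim hl' hb)))
    (list_cons.comp (pair (Mid_prim hl' hb) (pair (opI_prim.comp hl') hb)) (const []))

theorem trI_prim : Primrec trI := by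
  open Primrec in
  have hq : Primrec (fun p : Instr × ℕ => Qs p.1.1) := Qs_prim.comp (fst.comp fst)
  have hq' : Primrec (fun p : Instr × ℕ => Qs p.1.2.2) := Qs_prim.comp (snd.comp (snd.comp fst))
  have hj : Primrec (fun p : Instr × ℕ => p.2 + 1) := succ.comp snd
  have h1 : Primrec₂ (fun (t : Instr) (j : ℕ) => mv (Qs t.1) 0 (j+1) (Qs t.2.2)) :=
    mv_prim hq (const 0) hj hq'
  have h2 : Primrec₂ (fun (t : Instr) (j : ℕ) => mv (Qs t.1) (j+1) 0 (Qs t.2.2)) :=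
    mv_prim hq hj (const 0) hq'
  have h3 : Primrec₂ (fun (t : Instr) (j : ℕ) => [(Qs t.1, opZ (j+1), Qs t.2.2)]) :=
    list_cons.comp (pair hq (pair (opZ_prim.comp hj) hq')) (const [])
  have h4 : Primrec₂ (fun (t : Instr) (x : ℕ ⊕ ℕ) =>
      Sum.elim (fun j => mv (Qs t.1) (j+1) 0 (Qs t.2.2))
      (fun j => [(Qs t.1, opZ (j+1), Qs t.2.2)]) x) := by
    refine (sumCasesOn (f := fun p : Instr × (ℕ ⊕ ℕ) => p.2)
      (g := fun p j => mv (Qs p.1.1) (j+1) 0 (Qs p.1.2.2))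
      (h := fun p j => [(Qs p.1.1, opZ (j+1), Qs p.1.2.2)]) snd
      (h2.comp (fst.comp fst) snd) (h3.comp (fst.comp fst) snd)).of_eq ?_
    rintro ⟨t, x | x⟩ <;> rfl
  refine list_cons.comp (pair (Qs_prim.comp fst) (const (opZ 0, Rs 1))) ?_
  refine (sumCasesOn (f := fun t : Instr => t.2.1) (fst.comp snd) h1 h4).of_eq ?_
  rintro ⟨q, j | j, q'⟩ <;> rfl

theorem JI_cnt {K st : ℕ} {I : List Instr} (hI : ∀ t ∈ I, CMOp.counter t.2.1 < K) :
    ∀ t ∈ JI K st I, CMOp.counter t.2.1 < K + 1 := by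
  have hmv : ∀ a l l' b, l < K + 1 → l' < K + 1 → ∀ t ∈ mv a l l' b,
      CMOp.counter t.2.1 < K + 1 := by
    intro a l l' b h1 h2 t ht
    simp only [mv, List.mem_cons, List.not_mem_nil, or_false] at ht
    rcases ht with rfl | rfl
    · exact h1
    · exact h2
  intro t ht
  simp only [JI, resI, List.mem_cons, List.mem_append, List.mem_flatMap, List.mem_range] at ht
  rcases ht with rfl | rfl | rfl | ⟨j, hj, rfl | ht⟩ | ⟨⟨q, op, q'⟩, hu, ht⟩
  · exact Nat.succ_pos _
  · exact Nat.succ_pos _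
  · exact Nat.succ_pos _
  · exact Nat.succ_lt_succ hj
  · exact hmv _ _ _ _ (by omega) (by omega) t ht
  · simp only [trI, List.mem_cons] at ht
    have hcnt := hI _ hu
    rcases ht with rfl | ht
    · exact Nat.succ_pos _
    · rcases op with j | j | j
      · replace hcnt : j < K := hcnt
        exact hmv _ _ _ _ (by omega) (by omega) t ht
      · replace hcnt : j < K := hcnt
        exact hmv _ _ _ _ (by omega) (by omega) t ht
      · replace hcnt : j < K := hcnt
        simp only [Sum.elim_inr, List.mem_cons, List.not_mem_nil, or_false] at ht
        subst ht
        exact Nat.succ_lt_succ hcnt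

open Nat.Partrec in
def chi (n k : ℕ) : ℕ :=
  if (Code.evaln k (Denumerable.ofNat Code n) 0).isSome = true then 0 else 1

theorem chi_prim : Primrec₂ chi := by
  open Primrec in
  refine Primrec.ite ?_ (const 0) (const 1)
  refine Primrec.eq.comp ?_ (const true)
  refine option_isSome.comp (Nat.Partrec.Code.primrec_evaln.comp
    (pair (pair snd ((Primrec.ofNat _).comp fst)) (const 0)))

theorem lcm_undec : ¬ ComputablePred LCMOmegaReach := by
  intro hdec
  obtain ⟨K, I, st, hK, hIp, hstp, hcnt, hhalt, hinf⟩ := reliable_machine chi chi_prim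
    (by intro n k; unfold chi; split_ifs <;> omega)
  let g : ℕ → CMDesc × ℕ × ℕ := fun n => (mkM (K+1) (JI K (st n) (I n)), Rs (K+1), Vs)
  have hg : Primrec g := by
    open Primrec in
    refine pair ((mkM_prim _).comp ?_) (const _)
    refine list_cons.comp (pair (const _) (pair (const _) (Qs_prim.comp hstp)))
      (list_cons.comp (const _) (list_cons.comp (const _) (list_append.comp (const _) ?_)))
    exact list_flatMap hIp (trI_prim.comp snd)
  have key : ∀ c : Nat.Partrec.Code, LCMOmegaReach (g (Encodable.encode c)) ↔
      ¬ (c.eval 0).Dom := by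
    intro c
    constructor
    · rintro ⟨-, h⟩ hdom
      obtain ⟨x, hx⟩ := Part.dom_iff_mem.1 hdom
      obtain ⟨k, hk⟩ := Nat.Partrec.Code.evaln_complete.1 hx
      obtain ⟨s, hs⟩ := hhalt (Encodable.encode c) (by
        cases k with
        | zero => simp [Nat.Partrec.Code.evaln] at hk
        | succ k =>
          refine ⟨k, ?_⟩
          unfold chi
          rw [if_pos]
          rw [Denumerable.ofNat_encode]
          exact Option.isSome_iff_exists.2 ⟨x, hk⟩)
      obtain ⟨B, ρ, h0, h1, h2⟩ := h (s+2)
      have := visits_bound hs (hcnt _) (M := mkM (K+1) (JI K _ _)) rfl h0 h1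
      exact absurd (h2.trans this) (by omega)
    · intro hnd
      refine ⟨mkM_wf (by omega) (JI_cnt (hcnt _)), fun k => ?_⟩
      have hchi : ∀ k, chi (Encodable.encode c) k = 1 := by
        intro k
        unfold chi
        rw [if_neg]
        rw [Denumerable.ofNat_encode]
        intro h
        obtain ⟨x, hx⟩ := Option.isSome_iff_exists.1 h
        exact hnd (Part.dom_iff_mem.2 ⟨x, Nat.Partrec.Code.evaln_sound hx⟩)
      obtain ⟨σ, v, h1, h2⟩ := visits_unbounded (M := mkM (K+1) (JI K (st (Encodable.encode c))
        (I (Encodable.encode c)))) rfl hK (hcnt _) (hinf _ hchi) k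
      obtain ⟨B, ρ, h3, -, h4⟩ := h1.toFun
      exact ⟨B, ρ, h3.1, h3.2, h2.trans h4⟩
  have h1 : ComputablePred (fun c : Nat.Partrec.Code => ¬ (c.eval 0).Dom) :=
    hdec.computable_of_manyOneReducible
      ⟨fun c => g (Encodable.encode c), (hg.comp Primrec.encode).to_comp, fun c => (key c).symm⟩
  exact ComputablePred.halting_problem 0 ((h1.not).of_eq (fun c => not_not))
end partD3

/-- Satisfiability over expanding 2-frames with horizontal frame
`⟨ω,<⟩` and all vertical frames difference frames is undecidable; the lossy
counter-machine ω-reachability problem is computably many-one reducible to it. -/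
theorem omega_expanding_diff_undecidable :
    ¬ ComputablePred (BCodes (ExpDiffSat IsOmegaFrame)) ∧
    ManyOneReducible LCMOmegaReach (BCodes (ExpDiffSat IsOmegaFrame)) := by
  exact ⟨fun h => lcm_undec (h.computable_of_manyOneReducible lcm_reduces), lcm_reduces⟩

end HK
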